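/- arXiv:1812.08969 — 6 statements merged into one kernel-verified Lean document; each statement's English description precedes it below -/
import Mathlib

section
/- Let T > 0 and X° ∈ G. If each force F_i belongs to C([0,T] × G; ℝ^m), then there exists a mild solution X of the confined particle system ẋ_i(t) = H_i(t, X(t)) on [0,T] with initial condition X(0) = X°. -/
open Set MeasureTheory Filter
open scoped RealInnerProductSpace Topology NNReal ContDiff

noncomputable section

/-- Points of `ℝ^m`. -/
abbrev Pt (m : ℕ) := EuclideanSpace ℝ (Fin m)

/-- Configurations of `n` particles in `ℝ^m`, equipped with the sup-norm
`‖X‖ = max_i |x_i|`. -/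
abbrev Conf (m n : ℕ) := Fin n → Pt m

variable {m n : ℕ}

open Classical in
/-- Signed distance function with respect to the boundary of `Ω`:
nonpositive on `cl Ω`, positive outside. -/
def sgnDist (Ω : Set (Pt m)) (x : Pt m) : ℝ :=
  if x ∈ closure Ω then -Metric.infDist x (frontier Ω) else Metric.infDist x (frontier Ω)

/-- `Ω ⊆ ℝ^m` is a nonempty bounded open domain with `C²` boundary and outward
unit normal field `ν`: the signed distance function is `C²` near each boundary
point, and its gradient on the boundary is the outward unit normal `ν`. -/
structure IsC2Domain (Ω : Set (Pt m)) (ν : Pt m → Pt m) : Prop where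
  isOpen : IsOpen Ω
  nonempty : Ω.Nonempty
  bounded : Bornology.IsBounded Ω
  smoothBoundary : ∀ x ∈ frontier Ω, ContDiffAt ℝ 2 (sgnDist Ω) x
  grad_eq_normal : ∀ x ∈ frontier Ω, gradient (sgnDist Ω) x = ν x
  normal_unit : ∀ x ∈ frontier Ω, ‖ν x‖ = 1

open Classical in
/-- The one-sided projection `P(x,f)`: if `x ∈ ∂Ω` and `f · ν(x) > 0` then
`P(x,f) = f - (f·ν(x)) ν(x)`, otherwise `P(x,f) = f`. -/
def oneProj (Ω : Set (Pt m)) (ν : Pt m → Pt m) (x f : Pt m) : Pt m :=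
  if x ∈ frontier Ω ∧ 0 < ⟪f, ν x⟫ then f - ⟪f, ν x⟫ • ν x else f

/-- The set `G = (cl Ω)^n` of admissible configurations. -/
def Gset (Ω : Set (Pt m)) (n : ℕ) : Set (Conf m n) := {X | ∀ i, X i ∈ closure Ω}

/-- Mild solution of the confined particle system
`ẋ_i = H_i(t, X) = P(x_i, F_i(t,X))` on `[0,T]` with initial condition `X0`:
each `x_i` is continuous, stays in `cl Ω` and satisfies
`x_i(t) = x_i(0) + ∫₀ᵗ H_i(s, X(s)) ds`. -/
def IsMildSol (Ω : Set (Pt m)) (ν : Pt m → Pt m) (F : Fin n → ℝ → Conf m n → Pt m)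
    (T : ℝ) (X0 : Conf m n) (X : ℝ → Conf m n) : Prop :=
  (∀ i, ContinuousOn (fun t => X t i) (Icc 0 T)) ∧
  (∀ t ∈ Icc (0:ℝ) T, ∀ i, X t i ∈ closure Ω) ∧
  (∀ t ∈ Icc (0:ℝ) T, ∀ i,
    X t i = X0 i + ∫ s in (0:ℝ)..t, oneProj Ω ν (X s i) (F i s (X s)))

/-- The distance function `d(x) = dist(x, cl Ω)`. -/
def distCl (Ω : Set (Pt m)) (x : Pt m) : ℝ := Metric.infDist x (closure Ω)

open Classical in
/-- The function `d ∇d`, extended by `0` on `cl Ω`. -/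
def dGradd (Ω : Set (Pt m)) (x : Pt m) : Pt m :=
  if x ∈ closure Ω then 0 else distCl Ω x • gradient (distCl Ω) x

/-- Classical solution of the penalized system
`ẋ_i(t) = F_i(t, X(t)) - k (d∇d)(x_i(t))` on `[0,T]`. -/
def IsPenalSol (Ω : Set (Pt m)) (F : Fin n → ℝ → Conf m n → Pt m)
    (T k : ℝ) (X0 : Conf m n) (X : ℝ → Conf m n) : Prop :=
  X 0 = X0 ∧
  ∀ i, ∀ t ∈ Icc (0:ℝ) T,
    HasDerivWithinAt (fun s => X s i) (F i t (X t) - k • dGradd Ω (X t i)) (Icc 0 T) t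

/-- Admissible configurations with pairwise distinct particle positions. -/
def Gstar (Ω : Set (Pt m)) (n : ℕ) : Set (Conf m n) :=
  {X | (∀ i, X i ∈ closure Ω) ∧ ∀ i j, i ≠ j → X i ≠ X j}

/-- The particle interaction energy
`E(X) = (1/(n(n-1))) Σ_{j<i} V(x_i - x_j) + (1/n) Σ_i W(x_i)`. -/
def energy (V W : Pt m → ℝ) (X : Conf m n) : ℝ :=
  (1 / ((n : ℝ) * ((n : ℝ) - 1))) *
      ∑ i : Fin n, ∑ j ∈ Finset.filter (fun j => j < i) Finset.univ, V (X i - X j) +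
    (1 / (n : ℝ)) * ∑ i : Fin n, W (X i)

/-- The gradient `∇_{x_i} E(X)` of the energy with respect to particle `i`. -/
def Egrad (V W : Pt m → ℝ) (i : Fin n) (X : Conf m n) : Pt m :=
  gradient (fun y => energy V W (Function.update X i y)) (X i)

theorem aux_lip_approx {E F : Type*} [NormedAddCommGroup E] [NormedSpace ℝ E]
    [FiniteDimensional ℝ E] [NormedAddCommGroup F] [NormedSpace ℝ F]
    (b : E → F) (hb : Continuous b) (K : Set E) (hK : IsCompact K) (ε : ℝ) (hε : 0 < ε) :
    ∃ (g : E → F) (C L : ℝ≥0), LipschitzWith C g ∧ (∀ x, ‖g x‖ ≤ L) ∧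
      ∀ x ∈ K, dist (g x) (b x) < ε := by
  have : ProperSpace E := FiniteDimensional.proper ℝ E
  obtain ⟨f, f1, -, fc, -⟩ := exists_continuous_one_zero_of_isCompact hK isClosed_empty
    (disjoint_empty K)
  obtain ⟨g, g1, g2, g3⟩ := Continuous.exists_contDiff_approx (f := fun x => f x • b x)
    (ε := fun _ => ε) 1 (by fun_prop) continuous_const (fun _ => hε)
  have hgc : HasCompactSupport g := by
    refine fc.mono (g3.trans ?_)
    intro x hx hfx
    simp [hfx] at hx
  obtain ⟨C, hC⟩ := ContDiff.lipschitzWith_of_hasCompactSupport hgc g1 (by simp)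
  obtain ⟨L, hL⟩ := hgc.exists_bound_of_continuous g1.continuous
  refine ⟨g, C, L.toNNReal, hC, fun x => (hL x).trans (Real.le_coe_toNNReal L), fun x hx => ?_⟩
  have := g2 x
  rwa [f1 hx, Pi.one_apply, one_smul] at this

theorem aux_picard {E : Type*} [NormedAddCommGroup E] [NormedSpace ℝ E] [CompleteSpace E]
    (g : ℝ × E → E) (C L : ℝ≥0) (hg : LipschitzWith C g) (hL : ∀ x, ‖g x‖ ≤ L)
    (T : ℝ) (hT : 0 < T) (x0 : E) :
    ∃ x : ℝ → E, x 0 = x0 ∧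
      ∀ t ∈ Icc 0 T, HasDerivWithinAt x (g (t, x t)) (Icc 0 T) t := by
  have h : IsPicardLindelof (fun t x => g (t, x)) (tmin := 0) (tmax := T)
      ⟨0, le_refl _, hT.le⟩ x0 (L * T.toNNReal) 0 L C := by
    constructor
    · intro t _
      have := (hg.comp (LipschitzWith.prodMk_left (α := ℝ) (β := E) t))
      rw [mul_one] at this
      exact this.lipschitzOnWith
    · intro x _
      have := hg.continuous
      fun_prop
    · intro t _ x _
      exact hL _
    · simp [hT.le]
  exact h.exists_eq_forall_mem_Icc_hasDerivWithinAt₀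

theorem aux_incl {E : Type*} [NormedAddCommGroup E] [NormedSpace ℝ E] [CompleteSpace E]
    (K : Set E) (hKc : Convex ℝ K) (hK : IsClosed K) (T t0 : ℝ) (ht0 : t0 ∈ Ioo 0 T)
    (xs vs : ℕ → ℝ → E) (x : ℝ → E) (v : E)
    (hlim : ∀ t ∈ Icc 0 T, Tendsto (fun k => xs k t) atTop (𝓝 (x t)))
    (hd : ∀ k, ∀ t ∈ Icc 0 T, HasDerivWithinAt (xs k) (vs k t) (Icc 0 T) t)
    (hvc : ∀ k, ContinuousOn (vs k) (Icc 0 T))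
    (hx : HasDerivAt x v t0)
    (hnear : ∀ δ > 0, ∃ η > 0, ∃ k0 : ℕ, ∀ k ≥ k0, ∀ r ∈ Icc 0 T, |r - t0| < η →
      vs k r ∈ Metric.cthickening δ K) : v ∈ K := by
  rw [← hK.closure_eq, Metric.closure_eq_iInter_cthickening]
  simp only [mem_iInter]
  intro δ hδ
  obtain ⟨η, hη, k0, hk0⟩ := hnear δ hδ
  have key : ∀ᶠ t in 𝓝[>] t0, slope x t0 t ∈ Metric.cthickening δ K := by
    have h1 : ∀ᶠ t in 𝓝[>] t0, t < min T (t0 + η) :=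
      nhdsWithin_le_nhds (eventually_lt_nhds (lt_min ht0.2 (by linarith)))
    filter_upwards [h1, self_mem_nhdsWithin] with t ht (ht' : t0 < t)
    have htT : t < T := ht.trans_le (min_le_left _ _)
    have htη : t < t0 + η := ht.trans_le (min_le_right _ _)
    have hsub : Icc t0 t ⊆ Icc 0 T := Icc_subset_Icc ht0.1.le htT.le
    have hl : Tendsto (fun k => slope (xs k) t0 t) atTop (𝓝 (slope x t0 t)) := by
      simp only [slope_def_module]
      exact ((hlim t (hsub ⟨ht'.le, le_rfl⟩)).sub
        (hlim t0 (hsub ⟨le_rfl, ht'.le⟩))).const_smul _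
    refine Metric.isClosed_cthickening.mem_of_tendsto hl ?_
    filter_upwards [eventually_ge_atTop k0] with k hk
    have hint : IntervalIntegrable (vs k) volume t0 t :=
      ((hvc k).mono (by rwa [uIcc_of_le ht'.le])).intervalIntegrable
    have hftc : ∫ s in t0..t, vs k s = xs k t - xs k t0 := by
      refine intervalIntegral.integral_eq_sub_of_hasDerivAt_of_le ht'.le ?_ ?_ hint
      · exact fun s hs => ((hd k s (hsub hs)).continuousWithinAt).mono hsub
      · intro s hs
        exact (hd k s (hsub (Ioo_subset_Icc_self hs))).hasDerivAt
          (Icc_mem_nhds (ht0.1.trans hs.1) (hs.2.trans htT))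
    have hav : (⨍ s in t0..t, vs k s) ∈ Metric.cthickening δ K := by
      refine Convex.set_average_mem (hKc.cthickening δ) Metric.isClosed_cthickening ?_ ?_ ?_ ?_
      · simp [uIoc_of_le ht'.le, ht']
      · simp [uIoc_of_le ht'.le]
      · rw [ae_restrict_iff' measurableSet_uIoc]
        refine Eventually.of_forall fun s hs => ?_
        rw [uIoc_of_le ht'.le] at hs
        refine hk0 k hk s (hsub (Ioc_subset_Icc_self hs)) ?_
        rw [abs_lt]; constructor <;> linarith [hs.1, hs.2]
      · exact intervalIntegrable_iff.1 hint
    rw [interval_average_eq, hftc] at hav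
    rwa [slope_def_module]
  exact Metric.isClosed_cthickening.mem_of_tendsto
    ((hasDerivWithinAt_iff_tendsto_slope' (by simp : t0 ∉ Ioi t0)).1 hx.hasDerivWithinAt) key

theorem aux_ftc {E : Type*} [NormedAddCommGroup E] [NormedSpace ℝ E] [FiniteDimensional ℝ E]
    (x : ℝ → E) (C : ℝ≥0) (hx : LipschitzWith C x) (t : ℝ) :
    ∫ s in (0:ℝ)..t, deriv x s = x t - x 0 := by
  have : CompleteSpace E := FiniteDimensional.complete ℝ E
  have hb : ∀ s, ‖deriv x s‖ ≤ C := fun s => norm_deriv_le_of_lipschitz hx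
  have hli : LocallyIntegrable (deriv x) volume := by
    refine (locallyIntegrable_const (C : ℝ)).mono
      (stronglyMeasurable_deriv x).aestronglyMeasurable ?_
    exact Eventually.of_forall fun s => by simpa using hb s
  have hii : ∀ a b, IntervalIntegrable (deriv x) volume a b := fun a b =>
    intervalIntegrable_iff.mpr <|
      (hli.integrableOn_isCompact isCompact_uIcc).mono_set uIoc_subset_uIcc
  have hy : LipschitzWith (C + C) (fun t => x t - ∫ s in (0:ℝ)..t, deriv x s) := by
    refine hx.sub (LipschitzWith.of_dist_le_mul fun a b => ?_)
    rw [dist_eq_norm, intervalIntegral.integral_interval_sub_left (hii _ _) (hii _ _), Real.dist_eq]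
    exact intervalIntegral.norm_integral_le_of_norm_le_const fun s _ => hb s
  obtain ⟨c, hc⟩ := (hy.lipschitzOnWith (s := uIcc 0 t)).absolutelyContinuousOnInterval
    |>.const_of_ae_hasDerivAt_zero (by
      filter_upwards [hx.ae_differentiableAt_real, LocallyIntegrable.ae_hasDerivAt_integral hli] with s h1 h2 _
      have h3 := h1.hasDerivAt.sub (h2 0)
      rw [sub_self] at h3
      exact h3)
  have h0 := hc 0 left_mem_uIcc
  have h1 := hc t right_mem_uIcc
  simp only [intervalIntegral.integral_same, sub_zero] at h0
  rw [h0, ← h1]; abel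

theorem aux_compact {E : Type*} [NormedAddCommGroup E] [ProperSpace E]
    (S : Set E) (hS : IsCompact S) (T : ℝ) (hT : 0 < T) (L : ℝ≥0) (X : ℕ → ℝ → E)
    (hX : ∀ k, LipschitzOnWith L (X k) (Icc 0 T)) (hXS : ∀ k, ∀ t ∈ Icc 0 T, X k t ∈ S) :
    ∃ (φ : ℕ → ℕ) (Y : ℝ → E), StrictMono φ ∧ LipschitzWith L Y ∧
      ∀ t ∈ Icc 0 T, Tendsto (fun k => X (φ k) t) atTop (𝓝 (Y t)) := by
  have hlip : ∀ k, LipschitzWith L ((Icc 0 T).domRestrict (X k)) := fun k =>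
    lipschitzOnWith_iff_restrict.1 (hX k)
  let f : ℕ → BoundedContinuousFunction (Icc (0:ℝ) T) E := fun k =>
    BoundedContinuousFunction.mkOfCompact ⟨(Icc 0 T).domRestrict (X k), (hlip k).continuous⟩
  let A : Set (BoundedContinuousFunction (Icc (0:ℝ) T) E) := range f
  have hc : IsCompact (closure A) := by
    refine BoundedContinuousFunction.arzela_ascoli S hS A ?_ ?_
    · rintro _ x ⟨k, rfl⟩
      exact hXS k x x.2
    · apply UniformEquicontinuous.equicontinuous
      refine LipschitzWith.uniformEquicontinuous _ L ?_
      rintro ⟨_, k, rfl⟩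
      exact hlip k
  obtain ⟨y, -, φ, hφ, hy⟩ := hc.tendsto_subseq (x := f) (fun k => subset_closure ⟨k, rfl⟩)
  have hpt : ∀ t, Tendsto (fun k => f (φ k) t) atTop (𝓝 (y t)) := fun t =>
    ((continuous_eval_const t).tendsto y).comp hy
  have hyl : LipschitzWith L y := by
    refine LipschitzWith.of_dist_le_mul fun a b => ?_
    refine le_of_tendsto ((hpt a).dist (hpt b)) (Eventually.of_forall fun k => ?_)
    exact (hlip (φ k)).dist_le_mul a b
  refine ⟨φ, fun t => y (projIcc 0 T hT.le t), hφ, ?_, ?_⟩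
  · have := hyl.comp (LipschitzWith.projIcc hT.le)
    rwa [mul_one] at this
  · intro t ht
    have := hpt ⟨t, ht⟩
    simp only [projIcc_of_mem hT.le ht]
    exact this

theorem aux_sgn_mem (Ω : Set (Pt m)) (y : Pt m) (h : sgnDist Ω y < 0) : y ∈ closure Ω := by
  by_contra hy
  rw [sgnDist, if_neg hy] at h
  exact absurd h (not_lt.2 Metric.infDist_nonneg)

theorem aux_sgn_nonpos (Ω : Set (Pt m)) (y : Pt m) (h : y ∈ closure Ω) : sgnDist Ω y ≤ 0 := by
  rw [sgnDist, if_pos h]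
  exact neg_nonpos.2 Metric.infDist_nonneg

theorem aux_sgn_zero (Ω : Set (Pt m)) (y : Pt m) (h : y ∈ frontier Ω) : sgnDist Ω y = 0 := by
  rw [sgnDist, if_pos (frontier_subset_closure h), Metric.infDist_zero_of_mem h, neg_zero]

theorem aux_sgn_deriv (Ω : Set (Pt m)) (ν : Pt m → Pt m) (hΩ : IsC2Domain Ω ν)
    (c : ℝ → Pt m) (v : Pt m) (s : Set ℝ) (t : ℝ) (hc : HasDerivWithinAt c v s t)
    (ht : c t ∈ frontier Ω) :
    HasDerivWithinAt (fun r => sgnDist Ω (c r)) ⟪ν (c t), v⟫ s t := by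
  have h1 : DifferentiableAt ℝ (sgnDist Ω) (c t) :=
    (hΩ.smoothBoundary _ ht).differentiableAt (by simp)
  have h2 := h1.hasGradientAt
  rw [hΩ.grad_eq_normal _ ht, hasGradientAt_iff_hasFDerivAt] at h2
  have h3 := h2.comp_hasDerivWithinAt t hc
  rw [InnerProductSpace.toDual_apply_apply] at h3
  exact h3

theorem aux_nu_cont (Ω : Set (Pt m)) (ν : Pt m → Pt m) (hΩ : IsC2Domain Ω ν) :
    ContinuousOn ν (frontier Ω) := by
  have h : ContinuousOn (gradient (sgnDist Ω)) (frontier Ω) := by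
    intro x hx
    apply ContinuousAt.continuousWithinAt
    have h1 : ContDiffAt ℝ 1 (fderiv ℝ (sgnDist Ω)) x :=
      (hΩ.smoothBoundary x hx).fderiv_right (by norm_num)
    unfold gradient
    exact (LinearIsometryEquiv.continuous _).continuousAt.comp h1.continuousAt
  exact h.congr fun x hx => (hΩ.grad_eq_normal x hx).symm

theorem aux_G_closed (Ω : Set (Pt m)) (n : ℕ) : IsClosed (Gset Ω n) := by
  have : Gset Ω n = Set.pi univ (fun _ => closure Ω) := by ext; simp [Gset]
  rw [this]
  exact isClosed_set_pi fun _ _ => isClosed_closure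

theorem aux_G_compact (Ω : Set (Pt m)) (n : ℕ) (h : Bornology.IsBounded Ω) :
    IsCompact (Gset Ω n) := by
  have : Gset Ω n = Set.pi univ (fun _ => closure Ω) := by ext; simp [Gset]
  rw [this]
  exact isCompact_univ_pi fun _ => h.isCompact_closure

theorem aux_invariant (Ω : Set (Pt m)) (ν : Pt m → Pt m) (hΩ : IsC2Domain Ω ν) (T : ℝ)
    (X V : ℝ → Conf m n) (h0 : X 0 ∈ Gset Ω n)
    (hd : ∀ t ∈ Icc 0 T, HasDerivWithinAt X (V t) (Icc 0 T) t)
    (hin : ∀ t ∈ Icc 0 T, X t ∈ Gset Ω n → ∀ i, X t i ∈ frontier Ω → ⟪ν (X t i), V t i⟫ < 0) :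
    ∀ t ∈ Icc 0 T, X t ∈ Gset Ω n := by
  have hcont : ContinuousOn X (Icc 0 T) := fun t ht => (hd t ht).continuousWithinAt
  have hsub : Icc 0 T ⊆ {t | X t ∈ Gset Ω n} := by
    refine IsClosed.Icc_subset_of_forall_mem_nhdsWithin ?_ h0 ?_
    · rw [inter_comm]
      exact hcont.preimage_isClosed_of_isClosed isClosed_Icc (aux_G_closed Ω n)
    · rintro t ⟨htG, ht⟩
      have htI : t ∈ Icc 0 T := Ico_subset_Icc_self ht
      have hle : 𝓝[>] t ≤ 𝓝[Icc 0 T] t := by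
        rw [← nhdsWithin_Ioc_eq_nhdsGT ht.2]
        exact nhdsWithin_mono _ fun s hs => ⟨ht.1.trans hs.1.le, hs.2⟩
      have : ∀ᶠ s in 𝓝[>] t, ∀ i, X s i ∈ closure Ω := by
        rw [eventually_all]
        intro i
        have hdi : HasDerivWithinAt (fun s => X s i) (V t i) (Icc 0 T) t :=
          hasDerivWithinAt_pi.1 (hd t htI) i
        by_cases hf : X t i ∈ frontier Ω
        · have h1 := aux_sgn_deriv Ω ν hΩ _ _ _ _ hdi hf
          have h2 : HasDerivWithinAt (fun r => sgnDist Ω (X r i)) ⟪ν (X t i), V t i⟫ (Ioi t) t := by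
            have h3 : HasDerivWithinAt (fun r => sgnDist Ω (X r i)) ⟪ν (X t i), V t i⟫
              (Ioc t T) t := h1.mono fun s hs => ⟨ht.1.trans hs.1.le, hs.2⟩
            refine h3.mono_of_mem_nhdsWithin ?_
            exact Ioc_mem_nhdsGT ht.2
          have h4 := (hasDerivWithinAt_iff_tendsto_slope' (by simp : t ∉ Ioi t)).1 h2
          have h5 := h4.eventually (gt_mem_nhds (hin t htI htG i hf))
          filter_upwards [h5, self_mem_nhdsWithin] with s hs (hs' : t < s)
          apply aux_sgn_mem
          rw [slope_def_field, aux_sgn_zero _ _ hf, sub_zero] at hs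
          by_contra hneg
          exact absurd hs (not_lt.2 (div_nonneg (not_lt.1 hneg) (sub_pos.2 hs').le))
        · have hint : X t i ∈ Ω := by
            have := htG i
            rw [closure_eq_interior_union_frontier, hΩ.isOpen.interior_eq] at this
            exact this.resolve_right hf
          have := (hdi.continuousWithinAt.mono_left hle).eventually (hΩ.isOpen.mem_nhds hint)
          filter_upwards [this] with s hs using subset_closure hs
      exact this
  exact hsub

theorem aux_approx (Ω : Set (Pt m)) (ν : Pt m → Pt m) (hΩ : IsC2Domain Ω ν) (T : ℝ)
    (hT : 0 < T) (X0 : Conf m n) (hX0 : X0 ∈ Gset Ω n)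
    (Φ : Fin n → ℝ × Conf m n → Pt m) (hΦ : ∀ i, Continuous (Φ i))
    (N : Pt m → Pt m) (hN : Continuous N) (hNν : ∀ x ∈ frontier Ω, N x = ν x)
    (D : Pt m → ℝ) (hD : Continuous D) (hD0 : ∀ x ∈ frontier Ω, D x = 0) (hDn : ∀ x, 0 ≤ D x)
    (C : ℝ) (hC : ∀ p ∈ Icc 0 T ×ˢ Gset Ω n, ∀ i, |⟪Φ i p, N (p.2 i)⟫| ≤ C)
    (ε : ℝ) (hε : 0 < ε) (hε1 : ε ≤ 1) :
    ∃ X V : ℝ → Conf m n, X 0 = X0 ∧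
      (∀ t ∈ Icc 0 T, HasDerivWithinAt X (V t) (Icc 0 T) t) ∧ ContinuousOn V (Icc 0 T) ∧
      (∀ t ∈ Icc 0 T, X t ∈ Gset Ω n) ∧
      ∀ t ∈ Icc 0 T, ∀ i, ∃ l ∈ Icc 0 (C + 1),
        ‖V t i - (Φ i (t, X t) - l • N (X t i))‖ ≤ ε ∧ (ε ≤ D (X t i) → l = 0) := by
  let lam : Fin n → ℝ × Conf m n → ℝ := fun i p =>
    (max 0 ⟪Φ i p, N (p.2 i)⟫ + ε) * max 0 (1 - D (p.2 i) / ε)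
  have hlam : ∀ i, Continuous (lam i) := by
    intro i
    have := hΦ i
    fun_prop
  let b : ℝ × Conf m n → Conf m n := fun p i => Φ i p - lam i p • N (p.2 i)
  have hb : Continuous b := by
    refine continuous_pi fun i => ?_
    have := hΦ i
    have := hlam i
    fun_prop
  obtain ⟨g, Lc, L, hg, hL, hgb⟩ := aux_lip_approx b hb (Icc 0 T ×ˢ Gset Ω n)
    (isCompact_Icc.prod (aux_G_compact Ω n hΩ.bounded)) (ε / 2) (by positivity)
  obtain ⟨X, hXi, hXd⟩ := aux_picard g Lc L hg hL T hT X0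
  have hclose : ∀ t ∈ Icc 0 T, X t ∈ Gset Ω n → ∀ i, ‖g (t, X t) i - b (t, X t) i‖ < ε / 2 := by
    intro t ht hG i
    have h1 := hgb (t, X t) ⟨ht, hG⟩
    rw [dist_eq_norm] at h1
    exact (norm_le_pi_norm (g (t, X t) - b (t, X t)) i).trans_lt h1
  have hG : ∀ t ∈ Icc 0 T, X t ∈ Gset Ω n := by
    refine aux_invariant Ω ν hΩ T X (fun t => g (t, X t)) (hXi ▸ hX0) hXd ?_
    intro t ht hG i hf
    have h1 := hclose t ht hG i
    have hν := hΩ.normal_unit _ hf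
    have hb' : b (t, X t) i = Φ i (t, X t)
        - (max 0 ⟪Φ i (t, X t), ν (X t i)⟫ + ε) • ν (X t i) := by
      simp [b, lam, hNν _ hf, hD0 _ hf]
    have h2 : ⟪ν (X t i), b (t, X t) i⟫ ≤ -ε := by
      rw [hb', inner_sub_right, inner_smul_right, real_inner_self_eq_norm_sq, hν,
        real_inner_comm]
      have := le_max_right 0 ⟪Φ i (t, X t), ν (X t i)⟫
      linarith
    have h3 : ⟪ν (X t i), g (t, X t) i - b (t, X t) i⟫ ≤ ε / 2 := by
      refine (real_inner_le_norm _ _).trans ?_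
      rw [hν, one_mul]; exact h1.le
    rw [inner_sub_right] at h3
    change ⟪ν (X t i), g (t, X t) i⟫ < 0
    linarith
  refine ⟨X, fun t => g (t, X t), hXi, hXd, ?_, hG, ?_⟩
  · have hXc : ContinuousOn X (Icc 0 T) := fun t ht => (hXd t ht).continuousWithinAt
    exact hg.continuous.comp_continuousOn (continuousOn_id.prodMk hXc)
  · intro t ht i
    refine ⟨lam i (t, X t), ⟨?_, ?_⟩, ?_, ?_⟩
    · have := le_max_left 0 ⟪Φ i (t, X t), N (X t i)⟫
      exact mul_nonneg (by positivity) (le_max_left _ _)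
    · have h1 := hC (t, X t) ⟨ht, hG t ht⟩ i
      have h2 : max 0 ⟪Φ i (t, X t), N (X t i)⟫ ≤ C :=
        max_le ((abs_nonneg _).trans h1) ((le_abs_self _).trans h1)
      have h3 : max 0 (1 - D (X t i) / ε) ≤ 1 :=
        max_le zero_le_one (by have := div_nonneg (hDn (X t i)) hε.le; linarith)
      have h4 := le_max_left 0 ⟪Φ i (t, X t), N (X t i)⟫
      calc lam i (t, X t) ≤ (max 0 ⟪Φ i (t, X t), N (X t i)⟫ + ε) * 1 :=
            mul_le_mul_of_nonneg_left h3 (by positivity)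
        _ ≤ C + 1 := by linarith
    · exact ((hclose t ht (hG t ht) i).trans (by linarith)).le
    · intro h
      have : 1 ≤ D (X t i) / ε := (one_le_div hε).2 h
      simp only [lam]
      rw [max_eq_left (by linarith : 1 - D (X t i) / ε ≤ 0), mul_zero]

/-- Identification of the velocity at a point of differentiability. -/
theorem aux_ident (Ω : Set (Pt m)) (ν : Pt m → Pt m) (hΩ : IsC2Domain Ω ν) (T t0 : ℝ)
    (ht0 : t0 ∈ Ioo 0 T) (c : ℝ → Pt m) (hc : ∀ t ∈ Icc 0 T, c t ∈ closure Ω) (v f : Pt m)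
    (hv : HasDerivAt c v t0) (l : ℝ) (hl : 0 ≤ l) (hl0 : c t0 ∉ frontier Ω → l = 0)
    (w : Pt m) (hw : c t0 ∈ frontier Ω → w = ν (c t0)) (hvl : v = f - l • w) : v = oneProj Ω ν (c t0) f := by
  by_cases hf : c t0 ∈ frontier Ω
  · rw [hw hf] at hvl
    have hloc : IsLocalMax (fun r => sgnDist Ω (c r)) t0 := by
      filter_upwards [Icc_mem_nhds ht0.1 ht0.2] with t ht
      rw [aux_sgn_zero _ _ hf]
      exact aux_sgn_nonpos _ _ (hc t ht)
    have hd := aux_sgn_deriv Ω ν hΩ c v univ t0 hv.hasDerivWithinAt hf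
    rw [hasDerivWithinAt_univ] at hd
    have h0 := hloc.hasDerivAt_eq_zero hd
    rw [hvl, inner_sub_right, inner_smul_right, real_inner_self_eq_norm_sq,
      hΩ.normal_unit _ hf, real_inner_comm] at h0
    have hl' : l = ⟪f, ν (c t0)⟫ := by linarith
    unfold oneProj
    split_ifs with h
    · rw [hvl, hl']
    · have : l = 0 := by
        refine le_antisymm ?_ hl
        rw [hl']
        exact not_lt.1 fun h' => h ⟨hf, h'⟩
      rw [hvl, this, zero_smul, sub_zero]
  · rw [oneProj, if_neg (fun h => hf h.1), hvl, hl0 hf, zero_smul, sub_zero]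

/-- **Theorem (existence of mild solutions).**
If `T > 0`, `X° ∈ G` and each `F_i ∈ C([0,T] × G; ℝ^m)`, then the confined
particle system `ẋ_i = H_i(t,X) = P(x_i, F_i(t,X))`, `X(0) = X°`, has a mild
solution on `[0,T]`. -/
theorem exists_mildSol {m n : ℕ} (Ω : Set (Pt m)) (ν : Pt m → Pt m)
    (hΩ : IsC2Domain Ω ν) (T : ℝ) (hT : 0 < T)
    (F : Fin n → ℝ → Conf m n → Pt m)
    (hF : ∀ i, ContinuousOn (fun p : ℝ × Conf m n => F i p.1 p.2)
      (Icc 0 T ×ˢ Gset Ω n))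
    (X0 : Conf m n) (hX0 : X0 ∈ Gset Ω n) :
    ∃ X : ℝ → Conf m n, IsMildSol Ω ν F T X0 X := by
  classical
  have hGc := aux_G_compact Ω n hΩ.bounded
  have hGcl := aux_G_closed Ω n
  -- continuous extensions of the forces and of the normal field
  have hΦex : ∀ i, ∃ Φ : ℝ × Conf m n → Pt m, Continuous Φ ∧
      ∀ p ∈ Icc 0 T ×ˢ Gset Ω n, Φ p = F i p.1 p.2 := by
    intro i
    obtain ⟨g, hg⟩ := ContinuousMap.exists_restrict_eq (isClosed_Icc.prod hGcl)
      ⟨_, (hF i).domRestrict⟩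
    exact ⟨g, g.continuous, fun p hp => congrArg (fun h => h ⟨p, hp⟩) hg⟩
  choose Φ hΦ hΦF using hΦex
  obtain ⟨N, hN, hNν⟩ : ∃ N : Pt m → Pt m, Continuous N ∧ ∀ x ∈ frontier Ω, N x = ν x := by
    obtain ⟨g, hg⟩ := ContinuousMap.exists_restrict_eq (isClosed_frontier (s := Ω))
      ⟨_, (aux_nu_cont Ω ν hΩ).domRestrict⟩
    exact ⟨g, g.continuous, fun p hp => congrArg (fun h => h ⟨p, hp⟩) hg⟩
  obtain ⟨D, hD, hD0, hDn, hDp⟩ : ∃ D : Pt m → ℝ, Continuous D ∧ (∀ x ∈ frontier Ω, D x = 0) ∧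
      (∀ x, 0 ≤ D x) ∧ ∀ x, x ∉ frontier Ω → 0 < D x := by
    rcases (frontier Ω).eq_empty_or_nonempty with h | h
    · exact ⟨fun _ => 1, continuous_const, by simp [h], by simp, by simp⟩
    · exact ⟨fun x => Metric.infDist x (frontier Ω), Metric.continuous_infDist_pt _,
        fun x hx => Metric.infDist_zero_of_mem hx, fun x => Metric.infDist_nonneg,
        fun x hx => (isClosed_frontier.notMem_iff_infDist_pos h).1 hx⟩
  -- bounds
  have hKc : IsCompact (Icc 0 T ×ˢ Gset Ω n) := isCompact_Icc.prod hGc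
  obtain ⟨M, hM⟩ := hKc.exists_bound_of_continuousOn (f := fun p (i : Fin n) => Φ i p)
    (continuous_pi hΦ).continuousOn
  obtain ⟨R, hR⟩ := hKc.exists_bound_of_continuousOn (f := fun p (i : Fin n) => N (p.2 i))
    (by fun_prop)
  have hp0 : ((0 : ℝ), X0) ∈ Icc 0 T ×ˢ Gset Ω n := ⟨⟨le_rfl, hT.le⟩, hX0⟩
  have hM0 : 0 ≤ M := (norm_nonneg _).trans (hM _ hp0)
  have hR0 : 0 ≤ R := (norm_nonneg _).trans (hR _ hp0)
  have hMi : ∀ p ∈ Icc 0 T ×ˢ Gset Ω n, ∀ i, ‖Φ i p‖ ≤ M := fun p hp i =>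
    (norm_le_pi_norm (fun i => Φ i p) i).trans (hM p hp)
  have hRi : ∀ p ∈ Icc 0 T ×ˢ Gset Ω n, ∀ i, ‖N (p.2 i)‖ ≤ R := fun p hp i =>
    (norm_le_pi_norm (fun i => N (p.2 i)) i).trans (hR p hp)
  have hC : ∀ p ∈ Icc 0 T ×ˢ Gset Ω n, ∀ i, |⟪Φ i p, N (p.2 i)⟫| ≤ M * R := by
    intro p hp i
    exact (abs_real_inner_le_norm _ _).trans
      (mul_le_mul (hMi p hp i) (hRi p hp i) (norm_nonneg _) hM0)
  set C := M * R with hCdef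
  have hC0 : 0 ≤ C := mul_nonneg hM0 hR0
  -- approximations
  let e : ℕ → ℝ := fun k => 1 / ((k : ℝ) + 1)
  have he : ∀ k, 0 < e k := fun k => Nat.one_div_pos_of_nat
  have he1 : ∀ k, e k ≤ 1 := fun k => by
    have := Nat.one_div_le_one_div (α := ℝ) (Nat.zero_le k)
    simpa [e] using this
  have hetend : Tendsto e atTop (𝓝 0) := tendsto_one_div_add_atTop_nhds_zero_nat
  choose X V hXi hXd hVc hXG hXV using fun k => aux_approx Ω ν hΩ T hT X0 hX0 Φ hΦ N hN hNν
    D hD hD0 hDn C hC (e k) (he k) (he1 k)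
  let L : ℝ≥0 := ⟨M + (C + 1) * R + 1, by positivity⟩
  have hVb : ∀ k, ∀ t ∈ Icc 0 T, ‖V k t‖ ≤ L := by
    intro k t ht
    refine (pi_norm_le_iff_of_nonneg L.2).2 fun i => ?_
    obtain ⟨l, hl, hle, -⟩ := hXV k t ht i
    have hp : (t, X k t) ∈ Icc 0 T ×ˢ Gset Ω n := ⟨ht, hXG k t ht⟩
    have h1 := hMi _ hp i
    have h2 : ‖l • N (X k t i)‖ ≤ (C + 1) * R := by
      rw [norm_smul, Real.norm_of_nonneg hl.1]
      exact mul_le_mul hl.2 (hRi _ hp i) (norm_nonneg _) (by positivity)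
    calc ‖V k t i‖ = ‖(V k t i - (Φ i (t, X k t) - l • N (X k t i)))
            + (Φ i (t, X k t) - l • N (X k t i))‖ := by rw [sub_add_cancel]
      _ ≤ e k + (‖Φ i (t, X k t)‖ + ‖l • N (X k t i)‖) :=
          (norm_add_le _ _).trans (add_le_add hle (norm_sub_le _ _))
      _ ≤ M + (C + 1) * R + 1 := by linarith [he1 k]
  have hXL : ∀ k, LipschitzOnWith L (X k) (Icc 0 T) := fun k =>
    (convex_Icc 0 T).lipschitzOnWith_of_nnnorm_hasDerivWithin_le (hXd k)
      (fun t ht => hVb k t ht)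
  obtain ⟨φ, Y, hφ, hYL, hYt⟩ := aux_compact (Gset Ω n) hGc T hT L X hXL hXG
  have hYG : ∀ t ∈ Icc 0 T, Y t ∈ Gset Ω n := fun t ht =>
    hGcl.mem_of_tendsto (hYt t ht) (Eventually.of_forall fun k => hXG _ t ht)
  have hY0 : Y 0 = X0 := by
    refine tendsto_nhds_unique (hYt 0 ⟨le_rfl, hT.le⟩) ?_
    simp only [hXi]
    exact tendsto_const_nhds
  have hYLi : ∀ i, LipschitzWith L (fun t => Y t i) := fun i => by
    have := (LipschitzWith.eval (α := fun _ : Fin n => Pt m) i).comp hYL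
    rwa [one_mul] at this
  -- identification of the velocity
  have hvel : ∀ i, ∀ t0 ∈ Ioo 0 T, DifferentiableAt ℝ (fun t => Y t i) t0 →
      deriv (fun t => Y t i) t0 = oneProj Ω ν (Y t0 i) (F i t0 (Y t0)) := by
    intro i t0 ht0 hdiff
    have ht0' : t0 ∈ Icc 0 T := Ioo_subset_Icc_self ht0
    obtain ⟨c, hc1, hc2, hc3⟩ : ∃ c : ℝ, (Y t0 i ∈ frontier Ω → c = C + 1) ∧
        (Y t0 i ∉ frontier Ω → c = 0) ∧ 0 ≤ c := by
      by_cases h : Y t0 i ∈ frontier Ω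
      · exact ⟨C + 1, fun _ => rfl, fun h' => absurd h h', by positivity⟩
      · exact ⟨0, fun h' => absurd h' h, fun _ => rfl, le_rfl⟩
    let K : Set (Pt m) := (fun l : ℝ => Φ i (t0, Y t0) - l • N (Y t0 i)) '' Icc 0 c
    have hKclosed : IsClosed K := (isCompact_Icc.image (by fun_prop)).isClosed
    have hKconv : Convex ℝ K := by
      rintro _ ⟨a, ha, rfl⟩ _ ⟨b, hb, rfl⟩ p q hp hq hpq
      refine ⟨p • a + q • b, (convex_Icc 0 c) ha hb hp hq hpq, ?_⟩
      have hΦe : Φ i (t0, Y t0) = p • Φ i (t0, Y t0) + q • Φ i (t0, Y t0) := by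
        rw [← add_smul, hpq, one_smul]
      simp only [smul_eq_mul, smul_sub, add_smul, mul_smul]
      nth_rewrite 1 [hΦe]
      abel
    have hmem : deriv (fun t => Y t i) t0 ∈ K := by
      refine aux_incl K hKconv hKclosed T t0 ht0 (fun k t => X (φ k) t i)
        (fun k t => V (φ k) t i) (fun t => Y t i) _ ?_ ?_ ?_ hdiff.hasDerivAt ?_
      · exact fun t ht => tendsto_pi_nhds.1 (hYt t ht) i
      · exact fun k t ht => hasDerivWithinAt_pi.1 (hXd (φ k) t ht) i
      · exact fun k => continuousOn_pi.1 (hVc (φ k)) i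
      · intro δ hδ
        -- a neighbourhood on which everything is close
        have hev : ∀ᶠ p : ℝ × Conf m n in 𝓝 (t0, Y t0),
            ‖Φ i p - Φ i (t0, Y t0)‖ < δ / 3 ∧
            ‖N (p.2 i) - N (Y t0 i)‖ < δ / (3 * (C + 1)) ∧
            (Y t0 i ∉ frontier Ω → D (Y t0 i) / 2 < D (p.2 i)) := by
          have hδ' : 0 < δ / (3 * (C + 1)) := by positivity
          refine Eventually.and ?_ (Eventually.and ?_ ?_)
          · have := (hΦ i).tendsto (t0, Y t0)
            exact ((tendsto_iff_norm_sub_tendsto_zero.1 this).eventually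
              (gt_mem_nhds (by positivity)))
          · have h1 : Continuous fun p : ℝ × Conf m n => N (p.2 i) := by fun_prop
            exact ((tendsto_iff_norm_sub_tendsto_zero.1 (h1.tendsto (t0, Y t0))).eventually
              (gt_mem_nhds hδ'))
          · by_cases h : Y t0 i ∈ frontier Ω
            · exact Eventually.of_forall fun p h' => absurd h h'
            · have h1 : Continuous fun p : ℝ × Conf m n => D (p.2 i) := by fun_prop
              have h2 := (h1.tendsto (t0, Y t0)).eventually
                (lt_mem_nhds (half_lt_self (hDp _ h)))
              filter_upwards [h2] with p hp _ using hp
        obtain ⟨r, hr, hball⟩ := Metric.eventually_nhds_iff.1 hev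
        have hk1 : ∀ᶠ k in atTop, dist (X (φ k) t0) (Y t0) < r / 2 :=
          (hYt t0 ht0').eventually (Metric.ball_mem_nhds _ (by positivity))
        have hetend' : Tendsto (fun k => e (φ k)) atTop (𝓝 0) := hetend.comp hφ.tendsto_atTop
        have hk2 : ∀ᶠ k in atTop, e (φ k) < δ / 3 :=
          hetend'.eventually (gt_mem_nhds (by positivity))
        have hk3 : ∀ᶠ k in atTop, Y t0 i ∉ frontier Ω → e (φ k) < D (Y t0 i) / 2 := by
          by_cases h : Y t0 i ∈ frontier Ω
          · exact Eventually.of_forall fun p h' => absurd h h'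
          · filter_upwards [hetend'.eventually (gt_mem_nhds (half_pos (hDp _ h)))] with k hk _
              using hk
        obtain ⟨k0, hk0⟩ := eventually_atTop.1 (hk1.and (hk2.and hk3))
        refine ⟨min r (r / (2 * (L + 1))), by positivity, k0, fun k hk s hs hst => ?_⟩
        obtain ⟨ha, hb, hcc⟩ := hk0 k hk
        have hLpos : (0 : ℝ) < L + 1 := by positivity
        have hdist : dist (s, X (φ k) s) (t0, Y t0) < r := by
          rw [Prod.dist_eq]
          refine max_lt ?_ ?_
          · rw [Real.dist_eq]; exact hst.trans_le (min_le_left _ _)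
          · have h1 := (hXL (φ k)).dist_le_mul s hs t0 ht0'
            rw [Real.dist_eq] at h1
            have h2 : (L : ℝ) * |s - t0| ≤ r / 2 := by
              have h3 : |s - t0| ≤ r / (2 * (L + 1)) := hst.le.trans (min_le_right _ _)
              calc (L : ℝ) * |s - t0| ≤ (L + 1) * (r / (2 * (L + 1))) :=
                    mul_le_mul (by linarith) h3 (abs_nonneg _) hLpos.le
                _ = r / 2 := by field_simp
            calc dist (X (φ k) s) (Y t0) ≤ _ := dist_triangle _ (X (φ k) t0) _
              _ < r := by linarith
        obtain ⟨h1, h2, h3⟩ := hball hdist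
        obtain ⟨l, hl, hle, hl0⟩ := hXV (φ k) s hs i
        have hlc : l ∈ Icc 0 c := by
          by_cases h : Y t0 i ∈ frontier Ω
          · rw [hc1 h]; exact hl
          · rw [hc2 h, hl0 ((hcc h).le.trans (h3 h).le)]; exact ⟨le_rfl, le_rfl⟩
        refine Metric.mem_cthickening_of_dist_le _ (Φ i (t0, Y t0) - l • N (Y t0 i)) _ _
          ⟨l, hlc, rfl⟩ ?_
        rw [dist_eq_norm]
        have h4 : ‖l • (N (X (φ k) s i) - N (Y t0 i))‖ ≤ δ / 3 := by
          rw [norm_smul, Real.norm_of_nonneg hl.1]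
          calc l * ‖N (X (φ k) s i) - N (Y t0 i)‖ ≤ (C + 1) * (δ / (3 * (C + 1))) :=
                mul_le_mul hl.2 h2.le (norm_nonneg _) (by positivity)
            _ = δ / 3 := by field_simp
        have h5 : V (φ k) s i - (Φ i (t0, Y t0) - l • N (Y t0 i))
            = (V (φ k) s i - (Φ i (s, X (φ k) s) - l • N (X (φ k) s i)))
              + ((Φ i (s, X (φ k) s) - Φ i (t0, Y t0))
                - l • (N (X (φ k) s i) - N (Y t0 i))) := by
          rw [smul_sub]; abel
        rw [h5]
        refine (norm_add_le _ _).trans ?_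
        have h6 := norm_sub_le (Φ i (s, X (φ k) s) - Φ i (t0, Y t0))
          (l • (N (X (φ k) s i) - N (Y t0 i)))
        linarith
    obtain ⟨l, hl, hlv⟩ := hmem
    refine aux_ident Ω ν hΩ T t0 ht0 (fun t => Y t i) (fun t ht => hYG t ht i) _ _
      hdiff.hasDerivAt l hl.1 (fun h => ?_) (N (Y t0 i)) (fun h => hNν _ h) ?_
    · have h2 := hl.2
      rw [hc2 h] at h2
      exact le_antisymm h2 hl.1
    · rw [← hlv, ← hΦF i (t0, Y t0) ⟨ht0', hYG t0 ht0'⟩]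
  refine ⟨Y, fun i => (hYLi i).continuous.continuousOn, fun t ht i => hYG t ht i, ?_⟩
  intro t ht i
  have hftc := aux_ftc (fun t => Y t i) L (hYLi i) t
  have hcongr : ∫ s in (0:ℝ)..t, deriv (fun t => Y t i) s
      = ∫ s in (0:ℝ)..t, oneProj Ω ν (Y s i) (F i s (Y s)) := by
    refine intervalIntegral.integral_congr_ae ?_
    have hne : ∀ᵐ s : ℝ, s ≠ T := by simp [ae_iff]
    filter_upwards [hne, (hYLi i).ae_differentiableAt_real] with s hsT hsd hs
    rw [uIoc_of_le ht.1] at hs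
    exact hvel i s ⟨hs.1, lt_of_le_of_ne (hs.2.trans ht.2) hsT⟩ hsd
  rw [← hcongr, hftc, hY0]
  abel
end
end

section
/- Let T > 0 and X° ∈ G. If each F_i ∈ C([0,T] × G; ℝ^m) satisfies the Lipschitz condition |F_i(t,X) − F_i(t,Y)| ≤ L‖X − Y‖ for some L > 0 and all t ∈ [0,T], X, Y ∈ (ℝ^m)^n, i = 1,…,n, then the mild solution of the confined particle system with initial condition X° is unique: any two mild solutions X, Y on [0,T] with X(0) = Y(0) = X° satisfy X(t) = Y(t) for all t ∈ [0,T]. -/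
open Set MeasureTheory Filter
open scoped RealInnerProductSpace Topology NNReal ContDiff

noncomputable section

variable {m n : ℕ}

/-- One-sided quadratic support inequality at the boundary, with a uniform constant. -/
lemma aux_kernel {m : ℕ} {Ω : Set (Pt m)} {ν : Pt m → Pt m} (hΩ : IsC2Domain Ω ν) :
    ∃ K : ℝ, 0 ≤ K ∧ ∀ x ∈ frontier Ω, ∀ y ∈ closure Ω, ⟪ν x, y - x⟫ ≤ K * ‖y - x‖ ^ 2 := by
  have hc : IsCompact (frontier Ω) :=
    Metric.isCompact_of_isClosed_isBounded isClosed_frontier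
      (hΩ.bounded.closure.subset frontier_subset_closure)
  have key : ∃ K : ℝ, 0 ≤ K ∧ ∀ x ∈ frontier Ω, x ∈ frontier Ω →
      ∀ y ∈ closure Ω, ⟪ν x, y - x⟫ ≤ K * ‖y - x‖ ^ 2 := by
    refine hc.induction_on (p := fun s => ∃ K : ℝ, 0 ≤ K ∧ ∀ x ∈ s, x ∈ frontier Ω →
      ∀ y ∈ closure Ω, ⟪ν x, y - x⟫ ≤ K * ‖y - x‖ ^ 2) ⟨0, le_rfl, by simp⟩ ?_ ?_ ?_
    · rintro s t hst ⟨K, hK, h⟩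
      exact ⟨K, hK, fun x hx => h x (hst hx)⟩
    · rintro s t ⟨K, hK, h⟩ ⟨K', hK', h'⟩
      refine ⟨K + K', by positivity, ?_⟩
      rintro x (hx | hx) hxf y hy
      · have := h x hx hxf y hy
        nlinarith [mul_nonneg hK' (sq_nonneg ‖y - x‖)]
      · have := h' x hx hxf y hy
        nlinarith [mul_nonneg hK (sq_nonneg ‖y - x‖)]
    · intro x0 hx0
      have hcd := hΩ.smoothBoundary x0 hx0
      have h1 : ContDiffAt ℝ 1 (fderiv ℝ (sgnDist Ω)) x0 :=
        hcd.fderiv_right (by norm_num)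
      obtain ⟨C, t, ht, hCt⟩ := h1.exists_lipschitzOnWith
      have h2 : ∀ᶠ z in 𝓝 x0, ContDiffAt ℝ 2 (sgnDist Ω) z := hcd.eventually (by simp)
      obtain ⟨r, hr, hball⟩ := Metric.mem_nhds_iff.1 (inter_mem ht h2)
      refine ⟨Metric.ball x0 (r/2), mem_nhdsWithin_of_mem_nhds
        (Metric.ball_mem_nhds _ (by positivity)), C + 2 / r, by positivity, ?_⟩
      intro x hx hxf y hy
      have hx' : dist x x0 < r/2 := hx
      by_cases hyx : ‖y - x‖ < r / 2
      · have hxb : x ∈ Metric.ball x0 r := by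
          rw [Metric.mem_ball]; linarith
        have hyb : y ∈ Metric.ball x0 r := by
          rw [Metric.mem_ball]
          have := dist_triangle y x x0
          rw [dist_eq_norm y x] at this
          linarith
        have hseg : segment ℝ x y ⊆ Metric.ball x0 r :=
          (convex_ball x0 r).segment_subset hxb hyb
        have hT := Convex.norm_image_sub_le_of_norm_fderiv_le' (𝕜 := ℝ) (f := sgnDist Ω)
          (s := segment ℝ x y) (x := x) (y := y) (φ := fderiv ℝ (sgnDist Ω) x)
          (C := C * ‖y - x‖)
          (fun z hz => by
            have hz2 : ContDiffAt ℝ 2 (sgnDist Ω) z := (hball (hseg hz)).2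
            exact hz2.differentiableAt (by norm_num))
          (fun z hz => by
            have a := hCt.dist_le_mul z (hball (hseg hz)).1 x (hball hxb).1
            rw [dist_eq_norm, dist_eq_norm] at a
            refine a.trans ?_
            gcongr
            have := norm_sub_le_of_mem_segment hz
            exact this)
          (convex_segment x y) (left_mem_segment ℝ x y) (right_mem_segment ℝ x y)
        have hsx : sgnDist Ω x = 0 := by
          simp [sgnDist, frontier_subset_closure hxf, Metric.infDist_zero_of_mem hxf]
        have hsy : sgnDist Ω y ≤ 0 := by
          simp [sgnDist, hy, Metric.infDist_nonneg]
        have hg : fderiv ℝ (sgnDist Ω) x (y - x) = ⟪ν x, y - x⟫ := by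
          rw [← hΩ.grad_eq_normal x hxf, gradient, InnerProductSpace.toDual_symm_apply]
        rw [hg, hsx, Real.norm_eq_abs] at hT
        have a := neg_le_of_abs_le hT
        have b : 0 ≤ 2 / r * ‖y - x‖ ^ 2 := by positivity
        nlinarith
      · push Not at hyx
        have a : ⟪ν x, y - x⟫ ≤ ‖y - x‖ := by
          have := real_inner_le_norm (ν x) (y - x)
          rwa [hΩ.normal_unit x hxf, one_mul] at this
        have b : 1 ≤ 2 / r * ‖y - x‖ := by
          rw [div_mul_eq_mul_div, le_div_iff₀ hr]; linarith
        have c : (0:ℝ) ≤ C := C.2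
        nlinarith [mul_nonneg c (sq_nonneg ‖y - x‖), norm_nonneg (y - x)]
  obtain ⟨K, hK, h⟩ := key
  exact ⟨K, hK, fun x hx => h x hx hx⟩

open Classical in
lemma oneProj_eq {m : ℕ} {Ω : Set (Pt m)} {ν : Pt m → Pt m} (hΩ : IsC2Domain Ω ν) (x f : Pt m) :
    oneProj Ω ν x f = f - max 0 ⟪f, (frontier Ω).indicator (gradient (sgnDist Ω)) x⟫ •
      (frontier Ω).indicator (gradient (sgnDist Ω)) x := by
  unfold oneProj
  by_cases hx : x ∈ frontier Ω
  · rw [indicator_of_mem hx, hΩ.grad_eq_normal x hx]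
    by_cases h : 0 < ⟪f, ν x⟫
    · rw [if_pos ⟨hx, h⟩, max_eq_right h.le]
    · rw [if_neg (fun h' => h h'.2), max_eq_left (not_lt.1 h)]; simp
  · simp [hx]

lemma oneProj_norm_le {m : ℕ} {Ω : Set (Pt m)} {ν : Pt m → Pt m} (hΩ : IsC2Domain Ω ν)
    (x f : Pt m) : ‖oneProj Ω ν x f‖ ≤ 2 * ‖f‖ := by
  unfold oneProj
  split_ifs with h
  · have h1 := hΩ.normal_unit x h.1
    have h2 := norm_sub_le f (⟪f, ν x⟫ • ν x)
    have h3 := abs_real_inner_le_norm f (ν x)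
    rw [norm_smul, h1, Real.norm_eq_abs] at h2
    rw [h1] at h3
    linarith
  · linarith [norm_nonneg f]

lemma gradient_measurable {m : ℕ} (f : Pt m → ℝ) : Measurable (gradient f) := by
  unfold gradient
  exact (LinearIsometryEquiv.continuous _).measurable.comp (measurable_fderiv ℝ f)

lemma oneProj_measurable {m : ℕ} {Ω : Set (Pt m)} {ν : Pt m → Pt m} (hΩ : IsC2Domain Ω ν)
    {x f : ℝ → Pt m} (hx : Continuous x) (hf : Continuous f) :
    Measurable (fun s => oneProj Ω ν (x s) (f s)) := by
  simp_rw [oneProj_eq hΩ]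
  have hv : Measurable (fun s => (frontier Ω).indicator (gradient (sgnDist Ω)) (x s)) :=
    ((gradient_measurable _).indicator isClosed_frontier.measurableSet).comp hx.measurable
  have hi : Measurable (fun s =>
      max (0:ℝ) ⟪f s, (frontier Ω).indicator (gradient (sgnDist Ω)) (x s)⟫) :=
    measurable_const.max (hf.measurable.inner hv)
  exact hf.measurable.sub (hi.smul hv)

lemma oneProj_inner {m : ℕ} {Ω : Set (Pt m)} {ν : Pt m → Pt m} (hΩ : IsC2Domain Ω ν)
    {K : ℝ} (hK : 0 ≤ K)
    (h : ∀ x ∈ frontier Ω, ∀ y ∈ closure Ω, ⟪ν x, y - x⟫ ≤ K * ‖y - x‖ ^ 2)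
    {x y : Pt m} (f : Pt m) (hy : y ∈ closure Ω) :
    ⟪x - y, oneProj Ω ν x f⟫ ≤ ⟪x - y, f⟫ + K * ‖f‖ * ‖x - y‖ ^ 2 := by
  unfold oneProj
  split_ifs with hc
  · have h1 := h x hc.1 y hy
    have h3 := real_inner_le_norm f (ν x)
    rw [hΩ.normal_unit x hc.1, mul_one] at h3
    rw [norm_sub_rev, ← neg_sub x y, inner_neg_right, real_inner_comm] at h1
    rw [inner_sub_right, inner_smul_right]
    have h4 := mul_le_mul_of_nonneg_left h1 hc.2.le
    have h5 : ⟪f, ν x⟫ * (K * ‖x - y‖ ^ 2) ≤ ‖f‖ * (K * ‖x - y‖ ^ 2) :=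
      mul_le_mul_of_nonneg_right h3 (by positivity)
    nlinarith
  · have : 0 ≤ K * ‖f‖ * ‖x - y‖ ^ 2 := by positivity
    linarith

/-- Energy inequality for Lipschitz curves. -/
lemma aux_energy {m : ℕ} {h : ℝ → Pt m} (hm : Measurable h) {M : ℝ} (hM : ∀ s, ‖h s‖ ≤ M)
    {w : ℝ → Pt m} (hw : ∀ t, w t = ∫ s in (0:ℝ)..t, h s) {g : ℝ → ℝ} (hg : Continuous g)
    (hle : ∀ s, ⟪w s, h s⟫ ≤ g s) {t : ℝ} (ht : 0 ≤ t) :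
    ‖w t‖ ^ 2 ≤ ∫ s in (0:ℝ)..t, 2 * g s := by
  have hM0 : 0 ≤ M := (norm_nonneg _).trans (hM 0)
  have hint : ∀ a b, IntervalIntegrable h volume a b := fun a b =>
    (intervalIntegrable_const (c := M)).mono_fun hm.aestronglyMeasurable
      (Eventually.of_forall fun s => by simpa [abs_of_nonneg hM0] using hM s)
  have hww : ∀ a b, ‖w a - w b‖ ≤ M * |a - b| := fun a b => by
    rw [hw, hw, intervalIntegral.integral_interval_sub_left (hint _ _) (hint _ _)]
    exact intervalIntegral.norm_integral_le_of_norm_le_const fun s _ => hM s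
  have hw0 : w 0 = 0 := by simp [hw]
  have hwb : ∀ a ∈ uIcc 0 t, ‖w a‖ ≤ M * t := fun a ha => by
    rw [uIcc_of_le ht] at ha
    have := hww a 0
    rw [hw0, sub_zero, sub_zero, abs_of_nonneg ha.1] at this
    exact this.trans (by gcongr; exact ha.2)
  have hLip : LipschitzOnWith (Real.toNNReal (2 * (M * t) * M)) (fun s => ‖w s‖ ^ 2) (uIcc 0 t) := by
    refine LipschitzOnWith.of_dist_le_mul fun a ha b hb => ?_
    rw [Real.coe_toNNReal _ (by positivity), Real.dist_eq, Real.dist_eq]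
    have e : ‖w a‖ ^ 2 - ‖w b‖ ^ 2 = (‖w a‖ + ‖w b‖) * (‖w a‖ - ‖w b‖) := by ring
    rw [e, abs_mul, abs_of_nonneg (by positivity : 0 ≤ ‖w a‖ + ‖w b‖), mul_assoc (2 * (M * t))]
    refine mul_le_mul ?_ ((abs_norm_sub_norm_le _ _).trans (hww a b)) (abs_nonneg _) (by positivity)
    linarith [hwb a ha, hwb b hb]
  have hAC := hLip.absolutelyContinuousOnInterval
  have hF := hAC.integral_deriv_eq_sub
  simp only [hw0, norm_zero] at hF
  have : ‖w t‖ ^ 2 = ∫ s in (0:ℝ)..t, deriv (fun s => ‖w s‖ ^ 2) s := by rw [hF]; ring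
  rw [this]
  refine intervalIntegral.integral_mono_ae ht hAC.intervalIntegrable_deriv
    ((continuous_const.mul hg).intervalIntegrable _ _) ?_
  have hloc : LocallyIntegrable h volume := by
    intro x
    exact ⟨Icc (x-1) (x+1), Icc_mem_nhds (by linarith) (by linarith),
      (intervalIntegrable_iff_integrableOn_Icc_of_le (by linarith)).1 (hint _ _)⟩
  filter_upwards [LocallyIntegrable.ae_hasDerivAt_integral hloc] with s hs
  have h1 : HasDerivAt w (h s) s := by
    have := hs 0
    rwa [← funext hw] at this
  rw [h1.norm_sq.deriv]
  linarith [hle s]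

/-- **Theorem (uniqueness of mild solutions).**
If each `F_i ∈ C([0,T] × G; ℝ^m)` satisfies the Lipschitz condition
`|F_i(t,X) − F_i(t,Y)| ≤ L‖X − Y‖`, then any two mild solutions of the confined
particle system with the same initial condition `X° ∈ G` coincide on `[0,T]`. -/
theorem mildSol_unique {m n : ℕ} (Ω : Set (Pt m)) (ν : Pt m → Pt m)
    (hΩ : IsC2Domain Ω ν) (T : ℝ) (hT : 0 < T)
    (F : Fin n → ℝ → Conf m n → Pt m)
    (hF : ∀ i, ContinuousOn (fun p : ℝ × Conf m n => F i p.1 p.2)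
      (Icc 0 T ×ˢ Gset Ω n))
    (L : ℝ) (hL : 0 < L)
    (hLip : ∀ i, ∀ t ∈ Icc (0:ℝ) T, ∀ X Y : Conf m n,
      ‖F i t X - F i t Y‖ ≤ L * ‖X - Y‖)
    (X0 : Conf m n) (hX0 : X0 ∈ Gset Ω n)
    (X Y : ℝ → Conf m n)
    (hX : IsMildSol Ω ν F T X0 X) (hY : IsMildSol Ω ν F T X0 Y) :
    ∀ t ∈ Icc (0:ℝ) T, X t = Y t := by
  obtain ⟨hXc, hXm, hXi⟩ := hX
  obtain ⟨hYc, hYm, hYi⟩ := hY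
  obtain ⟨K, hK, hKer⟩ := aux_kernel hΩ
  -- clamp the time variable
  set τ : ℝ → ℝ := fun s => projIcc 0 T hT.le s with hτ
  have hτc : Continuous τ := continuous_subtype_val.comp continuous_projIcc
  have hτm : ∀ s, τ s ∈ Icc (0:ℝ) T := fun s => (projIcc 0 T hT.le s).2
  have hτe : ∀ s ∈ Icc (0:ℝ) T, τ s = s := fun s hs => by simp [hτ, projIcc_of_mem hT.le hs]
  have hcl : ∀ Z : ℝ → Conf m n, (∀ i, ContinuousOn (fun t => Z t i) (Icc 0 T)) →
      Continuous (fun s => Z (τ s)) := fun Z hZ =>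
    continuous_pi fun i => (hZ i).comp_continuous hτc hτm
  have hXc' := hcl X hXc
  have hYc' := hcl Y hYc
  have hFc : ∀ Z : ℝ → Conf m n, Continuous (fun s => Z (τ s)) →
      (∀ t ∈ Icc (0:ℝ) T, ∀ i, Z t i ∈ closure Ω) →
      ∀ i, Continuous (fun s => F i (τ s) (Z (τ s))) := fun Z hZ hZm i =>
    (hF i).comp_continuous (hτc.prodMk hZ) fun s => ⟨hτm s, hZm _ (hτm s)⟩
  have hb : ∀ Z : ℝ → Conf m n, Continuous (fun s => Z (τ s)) →
      (∀ t ∈ Icc (0:ℝ) T, ∀ i, Z t i ∈ closure Ω) →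
      ∃ M, 0 ≤ M ∧ ∀ i s, ‖F i (τ s) (Z (τ s))‖ ≤ M := by
    intro Z hZ hZm
    have : ∀ i, ∃ M, ∀ s ∈ Icc (0:ℝ) T, ‖F i (τ s) (Z (τ s))‖ ≤ M := fun i =>
      isCompact_Icc.exists_bound_of_continuousOn (hFc Z hZ hZm i).continuousOn
    choose M hM using this
    refine ⟨∑ i, |M i|, by positivity, fun i s => ?_⟩
    have h1 := hM i (τ s) (hτm s)
    rw [hτe _ (hτm s)] at h1
    exact (h1.trans (le_abs_self _)).trans
      (Finset.single_le_sum (f := fun i => |M i|) (fun _ _ => abs_nonneg _) (Finset.mem_univ i))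
  obtain ⟨M, hM0, hMX⟩ := hb X hXc' hXm
  obtain ⟨N, hN0, hNY⟩ := hb Y hYc' hYm
  set u : ℝ → ℝ := fun s => ‖X (τ s) - Y (τ s)‖ ^ 2 with hu
  have huc : Continuous u := (hXc'.sub hYc').norm.pow 2
  set C : ℝ := L + K * M + K * N with hC
  have hC0 : 0 ≤ C := by positivity
  have huU : ∀ t ∈ Icc (0:ℝ) T, u t ≤ ∫ s in (0:ℝ)..t, 2 * (C * u s) := by
    intro t ht
    have hI0 : 0 ≤ ∫ s in (0:ℝ)..t, 2 * (C * u s) :=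
      intervalIntegral.integral_nonneg ht.1 fun s _ => by positivity
    suffices h : ∀ i, ‖X t i - Y t i‖ ^ 2 ≤ ∫ s in (0:ℝ)..t, 2 * (C * u s) by
      simp only [hu, hτe t ht]
      rw [← Real.le_sqrt (norm_nonneg _) hI0, pi_norm_le_iff_of_nonneg (Real.sqrt_nonneg _)]
      exact fun i => Real.le_sqrt_of_sq_le (h i)
    intro i
    set p : ℝ → Pt m := fun s => oneProj Ω ν (X (τ s) i) (F i (τ s) (X (τ s))) with hp
    set q : ℝ → Pt m := fun s => oneProj Ω ν (Y (τ s) i) (F i (τ s) (Y (τ s))) with hq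
    have hpm : Measurable p :=
      oneProj_measurable hΩ ((continuous_apply i).comp hXc') (hFc X hXc' hXm i)
    have hqm : Measurable q :=
      oneProj_measurable hΩ ((continuous_apply i).comp hYc') (hFc Y hYc' hYm i)
    have hpb : ∀ s, ‖p s‖ ≤ 2 * M := fun s =>
      (oneProj_norm_le hΩ _ _).trans (by linarith [hMX i s])
    have hqb : ∀ s, ‖q s‖ ≤ 2 * N := fun s =>
      (oneProj_norm_le hΩ _ _).trans (by linarith [hNY i s])
    have hint : ∀ (h : ℝ → Pt m) (B : ℝ), Measurable h → (∀ s, ‖h s‖ ≤ B) →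
        ∀ a b, IntervalIntegrable h volume a b := fun h B hm hB a b =>
      (intervalIntegrable_const (c := B)).mono_fun hm.aestronglyMeasurable
        (Eventually.of_forall fun s => (hB s).trans (le_abs_self B))
    have hw : ∀ s ∈ Icc (0:ℝ) T, X s i - Y s i = ∫ r in (0:ℝ)..s, (p r - q r) := by
      intro s hs
      rw [intervalIntegral.integral_sub (hint p _ hpm hpb _ _) (hint q _ hqm hqb _ _),
        hXi s hs i, hYi s hs i]
      have e1 : ∫ r in (0:ℝ)..s, p r = ∫ r in (0:ℝ)..s, oneProj Ω ν (X r i) (F i r (X r)) := by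
        refine intervalIntegral.integral_congr fun r hr => ?_
        rw [uIcc_of_le hs.1] at hr
        simp only [hp, hτe r ⟨hr.1, hr.2.trans hs.2⟩]
      have e2 : ∫ r in (0:ℝ)..s, q r = ∫ r in (0:ℝ)..s, oneProj Ω ν (Y r i) (F i r (Y r)) := by
        refine intervalIntegral.integral_congr fun r hr => ?_
        rw [uIcc_of_le hs.1] at hr
        simp only [hq, hτe r ⟨hr.1, hr.2.trans hs.2⟩]
      rw [e1, e2]
      abel
    -- kill the integrand outside `[0,T]`
    set h : ℝ → Pt m := (Icc (0:ℝ) T).indicator (fun r => p r - q r) with hh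
    have hhm : Measurable h := (hpm.sub hqm).indicator measurableSet_Icc
    have hhb : ∀ s, ‖h s‖ ≤ 2 * M + 2 * N := fun s =>
      (norm_indicator_le_norm_self _ _).trans
        ((norm_sub_le _ _).trans (add_le_add (hpb s) (hqb s)))
    have hwh : ∀ s ∈ Icc (0:ℝ) T, X s i - Y s i = ∫ r in (0:ℝ)..s, h r := by
      intro s hs
      rw [hw s hs]
      refine intervalIntegral.integral_congr fun r hr => ?_
      rw [uIcc_of_le hs.1] at hr
      simp only [hh]
      have hr' : r ∈ Icc (0:ℝ) T := ⟨hr.1, hr.2.trans hs.2⟩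
      rw [indicator_of_mem hr']
    rw [hwh t ht]
    refine aux_energy hhm hhb (w := fun t => ∫ s in (0:ℝ)..t, h s) (fun _ => rfl)
      (g := fun s => C * u s) (continuous_const.mul huc) (fun s => ?_) ht.1
    by_cases hs : s ∈ Icc (0:ℝ) T
    · simp only [← hwh s hs]
      simp only [hh]
      rw [indicator_of_mem hs]
      simp only [hp, hq, hu]
      have hMs := hMX i s
      have hNs := hNY i s
      rw [hτe s hs] at hMs hNs ⊢
      have k1 := oneProj_inner hΩ hK hKer (x := X s i) (F i s (X s)) (hYm s hs i)
      have k2 := oneProj_inner hΩ hK hKer (x := Y s i) (F i s (Y s)) (hXm s hs i)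
      rw [norm_sub_rev (Y s i), ← neg_sub (X s i) (Y s i), inner_neg_left, inner_neg_left] at k2
      have k3 : ‖X s i - Y s i‖ ≤ ‖X s - Y s‖ := norm_le_pi_norm (X s - Y s) i
      have k4 := real_inner_le_norm (X s i - Y s i) (F i s (X s) - F i s (Y s))
      have k5 := hLip i s hs (X s) (Y s)
      have k6 : ‖X s i - Y s i‖ * ‖F i s (X s) - F i s (Y s)‖ ≤ ‖X s - Y s‖ * (L * ‖X s - Y s‖) := by
        gcongr
      have k7 : K * ‖F i s (X s)‖ * ‖X s i - Y s i‖ ^ 2 ≤ K * M * ‖X s - Y s‖ ^ 2 := by gcongr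
      have k8 : K * ‖F i s (Y s)‖ * ‖X s i - Y s i‖ ^ 2 ≤ K * N * ‖X s - Y s‖ ^ 2 := by gcongr
      rw [inner_sub_right] at k4 ⊢
      have k9 : C * ‖X s - Y s‖ ^ 2 = ‖X s - Y s‖ * (L * ‖X s - Y s‖) + K * M * ‖X s - Y s‖ ^ 2
        + K * N * ‖X s - Y s‖ ^ 2 := by rw [hC]; ring
      linarith
    · simp only [hh]
      rw [indicator_of_notMem hs, inner_zero_right]
      positivity
  -- Gronwall
  have hUd : ∀ t, HasDerivAt (fun t => ∫ s in (0:ℝ)..t, 2 * (C * u s)) (2 * (C * u t)) t := fun t =>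
    (continuous_const.mul (continuous_const.mul huc)).integral_hasStrictDerivAt 0 t |>.hasDerivAt
  have hz := eq_zero_of_abs_deriv_le_mul_abs_self_of_eq_zero_right (K := 2 * C) (a := 0) (b := T)
    (f := fun t => ∫ s in (0:ℝ)..t, 2 * (C * u s))
    (fun t _ => (hUd t).continuousAt.continuousWithinAt)
    (fun t _ => (hUd t).hasDerivWithinAt) (by simp) (fun t ht => by
      have h1 := huU t ⟨ht.1, ht.2.le⟩
      have h0 : 0 ≤ u t := by positivity
      rw [Real.norm_of_nonneg (by positivity), Real.norm_of_nonneg (h0.trans h1)]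
      rw [← mul_assoc]
      gcongr)
  intro t ht
  have h1 := huU t ht
  rw [hz t ht] at h1
  simp only [hu, hτe t ht] at h1
  have h2 : ‖X t - Y t‖ = 0 := pow_eq_zero_iff (two_ne_zero) |>.1 (le_antisymm h1 (by positivity))
  exact sub_eq_zero.1 (norm_eq_zero.1 h2)
end
end

section
/- The function d∇d : cl N^ε(Ω) → ℝ^m, defined by d∇d(x) := d(x)∇d(x) for x ∈ cl N^ε(∂Ω) \ cl Ω and d∇d(x) := 0 for x ∈ cl Ω, is Lipschitz continuous on cl N^ε(Ω); that is, there exists C′ > 0 such that |d∇d(x) − d∇d(y)| ≤ C′|x − y| for all x, y ∈ cl N^ε(Ω). -/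
open Set MeasureTheory Filter
open scoped RealInnerProductSpace Topology NNReal ContDiff

noncomputable section

variable {m n : ℕ}

lemma gradient_contDiffAt {f : Pt m → ℝ} {x : Pt m} (hf : ContDiffAt ℝ 2 f x) :
    ContDiffAt ℝ 1 (gradient f) x := by
  have h1 : ContDiffAt ℝ 1 (fderiv ℝ f) x := hf.fderiv_right (by norm_num)
  exact (InnerProductSpace.toDual ℝ (Pt m)).symm.toContinuousLinearEquiv.contDiff.contDiffAt.comp
    x h1

lemma infDist_frontier_eq {Ω : Set (Pt m)} (ho : IsOpen Ω) (hne : Ω.Nonempty) {x : Pt m}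
    (hx : x ∉ closure Ω) : Metric.infDist x (frontier Ω) = Metric.infDist x (closure Ω) := by
  obtain ⟨y, hy, hxy⟩ := isClosed_closure.exists_infDist_eq_dist hne.closure x
  have hyx : 0 < dist x y := by
    rw [dist_pos]
    rintro rfl
    exact hx hy
  have hyf : y ∈ frontier Ω := by
    rw [ho.frontier_eq]
    refine ⟨hy, fun hyΩ => ?_⟩
    have hc : Tendsto (fun t : ℝ => y + t • (x - y)) (𝓝 0) (𝓝 y) := by
      have : Continuous (fun t : ℝ => y + t • (x - y)) := by fun_prop
      simpa using this.tendsto 0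
    have h1 : ∀ᶠ t in 𝓝[>] (0:ℝ), y + t • (x - y) ∈ Ω :=
      (hc.mono_left nhdsWithin_le_nhds) (ho.mem_nhds hyΩ)
    have h2 : ∀ᶠ t in 𝓝[>] (0:ℝ), t ∈ Ioo (0:ℝ) 1 := Ioo_mem_nhdsGT one_pos
    obtain ⟨t, ht, ht0, ht1⟩ := (h1.and h2).exists
    have h3 := Metric.infDist_le_dist_of_mem (x := x) (subset_closure ht)
    have h4 : dist x (y + t • (x - y)) = (1 - t) * dist x y := by
      rw [dist_eq_norm, dist_eq_norm,
        show x - (y + t • (x - y)) = (1 - t) • (x - y) by module, norm_smul,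
        Real.norm_of_nonneg (by linarith)]
    rw [hxy, h4] at h3
    nlinarith
  apply le_antisymm
  · rw [hxy]
    exact Metric.infDist_le_dist_of_mem hyf
  · exact Metric.infDist_le_infDist_of_subset frontier_subset_closure ⟨y, hyf⟩

lemma local_form_lipschitz {Ω : Set (Pt m)} {x : Pt m} {g : Pt m → Pt m}
    (hg : ContDiffAt ℝ 1 g x) (h : ∀ᶠ z in 𝓝 x, dGradd Ω z = distCl Ω z • g z) :
    ∃ K, ∃ t ∈ 𝓝 x, LipschitzOnWith K (dGradd Ω) t := by
  obtain ⟨K, t, ht, hK⟩ := hg.exists_lipschitzOnWith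
  have hM : ∀ᶠ z in 𝓝 x, ‖g z‖ < ‖g x‖ + 1 :=
    hg.continuousAt.norm.eventually_lt continuousAt_const (by simp)
  have hdc : Continuous (distCl Ω) := Metric.continuous_infDist_pt _
  have hD : ∀ᶠ z in 𝓝 x, distCl Ω z < distCl Ω x + 1 :=
    hdc.continuousAt.eventually_lt continuousAt_const (by simp)
  have hd0 : ∀ z, 0 ≤ distCl Ω z := fun z => Metric.infDist_nonneg
  have hd1 : ∀ a b, |distCl Ω a - distCl Ω b| ≤ dist a b := fun a b => by
    have := (Metric.lipschitz_infDist_pt (closure Ω)).dist_le_mul a b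
    simpa [Real.dist_eq, distCl] using this
  refine ⟨Real.toNNReal ((‖g x‖ + 1) + (distCl Ω x + 1) * K), _,
    inter_mem ht (inter_mem h (inter_mem hM hD)), ?_⟩
  apply LipschitzOnWith.of_dist_le_mul
  rintro a ⟨hat, ha, haM, -⟩ b ⟨hbt, hb, -, hbD⟩
  simp only [mem_ofPred_eq] at ha haM hb hbD
  have hx0 := hd0 x
  rw [Real.coe_toNNReal _ (by positivity), ha, hb, dist_eq_norm,
    show distCl Ω a • g a - distCl Ω b • g b
      = (distCl Ω a - distCl Ω b) • g a + distCl Ω b • (g a - g b) by module]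
  refine (norm_add_le _ _).trans ?_
  rw [norm_smul, norm_smul, Real.norm_eq_abs, Real.norm_of_nonneg (hd0 b), add_mul, ← dist_eq_norm]
  have h1 := hK.dist_le_mul a hat b hbt
  have h2 : |distCl Ω a - distCl Ω b| * ‖g a‖ ≤ dist a b * (‖g x‖ + 1) :=
    mul_le_mul (hd1 a b) haM.le (norm_nonneg _) dist_nonneg
  have h3 : distCl Ω b * dist (g a) (g b) ≤ (distCl Ω x + 1) * (K * dist a b) :=
    mul_le_mul hbD.le h1 dist_nonneg (by positivity)
  linarith

/-- **Proposition (Lipschitz continuity of `d∇d`).**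
The function `d∇d`, equal to `d(x)∇d(x)` outside `cl Ω` and to `0` on `cl Ω`,
is Lipschitz continuous on `cl N^ε(Ω)`. -/
theorem dGradd_lipschitzOn {m : ℕ} (Ω : Set (Pt m)) (ν : Pt m → Pt m)
    (hΩ : IsC2Domain Ω ν) (ε : ℝ) (hε : 0 < ε)
    (hd1 : ContDiffOn ℝ 2 (distCl Ω) (closure (Metric.thickening ε (frontier Ω)) \ Ω))
    (hd2 : ∀ x ∈ closure (Metric.thickening ε Ω) \ closure Ω,
      ContDiffAt ℝ 2 (distCl Ω) x) :
    ∃ C > (0:ℝ), ∀ x ∈ closure (Metric.thickening ε Ω),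
      ∀ y ∈ closure (Metric.thickening ε Ω),
        ‖dGradd Ω x - dGradd Ω y‖ ≤ C * ‖x - y‖ := by
  have hzero : ∀ z ∈ closure Ω, distCl Ω z = 0 := fun z hz => Metric.infDist_zero_of_mem hz
  have hcompact : IsCompact (closure (Metric.thickening ε Ω)) :=
    (hΩ.bounded.thickening (δ := ε)).isCompact_closure
  have hloc : LocallyLipschitzOn (closure (Metric.thickening ε Ω)) (dGradd Ω) := by
    intro x hx
    suffices H : ∃ g : Pt m → Pt m, ContDiffAt ℝ 1 g x ∧
        ∀ᶠ z in 𝓝 x, dGradd Ω z = distCl Ω z • g z by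
      obtain ⟨g, hg, h⟩ := H
      obtain ⟨K, t, ht, hK⟩ := local_form_lipschitz hg h
      exact ⟨K, t, mem_nhdsWithin_of_mem_nhds ht, hK⟩
    by_cases hxc : x ∈ closure Ω
    · by_cases hxo : x ∈ Ω
      · refine ⟨fun _ => 0, contDiffAt_const, ?_⟩
        filter_upwards [hΩ.isOpen.mem_nhds hxo] with z hz
        simp [dGradd, subset_closure hz]
      · have hxf : x ∈ frontier Ω := by
          rw [hΩ.isOpen.frontier_eq]
          exact ⟨hxc, hxo⟩
        refine ⟨_, gradient_contDiffAt (hΩ.smoothBoundary x hxf), ?_⟩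
        refine Eventually.of_forall fun z => ?_
        by_cases hz : z ∈ closure Ω
        · simp [dGradd, hz, hzero z hz]
        · have he : distCl Ω =ᶠ[𝓝 z] sgnDist Ω := by
            filter_upwards [isClosed_closure.isOpen_compl.mem_nhds hz] with w hw
            rw [sgnDist, if_neg hw, infDist_frontier_eq hΩ.isOpen hΩ.nonempty hw, distCl]
          rw [dGradd, if_neg hz, gradient, gradient, he.fderiv_eq]
    · refine ⟨_, gradient_contDiffAt (hd2 x ⟨hx, hxc⟩), ?_⟩
      filter_upwards [isClosed_closure.isOpen_compl.mem_nhds hxc] with w hw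
      rw [dGradd, if_neg hw]
  obtain ⟨K, hK⟩ := hloc.exists_lipschitzOnWith_of_compact hcompact
  refine ⟨K + 1, by positivity, fun x hx y hy => ?_⟩
  have h := hK.dist_le_mul x hx y hy
  rw [dist_eq_norm, dist_eq_norm] at h
  nlinarith [norm_nonneg (x - y)]
end
end

section
/- Let T > 0, suppose each F_i is continuous with ‖F‖_∞ := sup_{t,X,i} |F_i(t,X)| < ∞, and let k > ‖F‖_∞/ε. Then for any X° ∈ G there exists a classical C¹ solution X^k = {x_i^k} on [0,T] of the penalized system ẋ_i^k(t) = F_i(t, X^k(t)) − k(d∇d)(x_i^k(t)), x_i^k(0) = x_i°. Moreover, any such solution satisfies x_i^k(t) ∈ N^ε(Ω) and |ẋ_i^k(t)| ≤ 2‖F‖_∞ for all i = 1,…,n and all t ∈ [0,T]. -/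
open Set MeasureTheory Filter
open scoped RealInnerProductSpace Topology NNReal ContDiff

noncomputable section

variable {m n : ℕ}

section PeanoAux

variable {E : Type*} [NormedAddCommGroup E] [NormedSpace ℝ E]

theorem aux_int_lip (g : ℝ → E) (hg : Continuous g) (C : ℝ≥0) (hC : ∀ t, ‖g t‖ ≤ C) (x0 : E) :
    LipschitzWith C (fun t => x0 + ∫ s in (0:ℝ)..t, g s) := by
  refine LipschitzWith.of_dist_le_mul fun a b => ?_
  rw [dist_eq_norm, add_sub_add_left_eq_sub,
    intervalIntegral.integral_interval_sub_left (hg.intervalIntegrable _ _)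
      (hg.intervalIntegrable _ _), Real.dist_eq]
  exact intervalIntegral.norm_integral_le_of_norm_le_const fun s _ => hC s

/-- Tonelli (delayed) approximate solutions. -/
theorem aux_tonelli (G : ℝ → E → E) (hG : Continuous (Function.uncurry G)) (C : ℝ≥0)
    (hC : ∀ t x, ‖G t x‖ ≤ C) (x0 : E) (T δ : ℝ) (hδ : 0 < δ) :
    ∃ y : ℝ → E, LipschitzWith C y ∧
      ∀ t ∈ Icc (0:ℝ) T, y t = x0 + ∫ s in (0:ℝ)..t, G s (y (max (s - δ) 0)) := by
  let Φ : (ℝ → E) → ℝ → E := fun y t => x0 + ∫ s in (0:ℝ)..t, G s (y (max (s - δ) 0))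
  let Y : ℕ → ℝ → E := fun j => Φ^[j] (fun _ => x0)
  have hYs : ∀ j, Y (j+1) = Φ (Y j) := fun j => Function.iterate_succ_apply' Φ j _
  have hLip : ∀ j, LipschitzWith C (Y j) := by
    intro j
    induction j with
    | zero => exact (LipschitzWith.const x0).weaken (zero_le)
    | succ j ih =>
      rw [hYs]
      have := ih.continuous
      exact aux_int_lip _ (hG.comp (by fun_prop : Continuous fun s : ℝ => (s, Y j (max (s - δ) 0)))) C
        (fun t => hC _ _) x0
  have hfix : ∀ j : ℕ, ∀ t ∈ Icc (0:ℝ) (j * δ), Y (j+1) t = Y j t := by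
    intro j
    induction j with
    | zero =>
      intro t ht
      have : t = 0 := by simpa using ht
      subst this
      simp [hYs, Φ, Y]
    | succ j ih =>
      intro t ht
      rw [hYs (j+1)]
      conv_rhs => rw [hYs j]
      simp only [Φ]
      congr 1
      refine intervalIntegral.integral_congr fun s hs => ?_
      rw [uIcc_of_le ht.1] at hs
      have h2 := ht.2
      push_cast at h2
      rw [ih]
      refine ⟨le_max_right _ _, max_le ?_ (by positivity)⟩
      linarith [hs.2]
  obtain ⟨N, hN⟩ := exists_nat_ge (T / δ)
  refine ⟨Y N, hLip N, fun t ht => ?_⟩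
  rw [← hfix N t ⟨ht.1, ht.2.trans ((div_le_iff₀ hδ).1 hN)⟩, hYs]

theorem aux_peano [CompleteSpace E] [ProperSpace E] (G : ℝ → E → E) (hG : Continuous (Function.uncurry G)) (C : ℝ≥0)
    (hC : ∀ t x, ‖G t x‖ ≤ C) (x0 : E) (T : ℝ) (hT : 0 < T) :
    ∃ x : ℝ → E, x 0 = x0 ∧ ∀ t ∈ Icc (0:ℝ) T, HasDerivAt x (G t (x t)) t := by
  have hδ : ∀ j : ℕ, 0 < 1 / ((j:ℝ) + 1) := fun j => Nat.one_div_pos_of_nat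
  choose y hyL hy using fun j : ℕ => aux_tonelli G hG C hC x0 T (1 / ((j:ℝ) + 1)) (hδ j)
  let u : ℕ → BoundedContinuousFunction (Icc (0:ℝ) T) E := fun j =>
    BoundedContinuousFunction.mkOfCompact ⟨fun t => y j t, (hyL j).continuous.comp continuous_subtype_val⟩
  have hu : ∀ j (t : Icc (0:ℝ) T), u j t = y j t := fun _ _ => rfl
  have hy0 : ∀ j, y j 0 = x0 := fun j => by
    rw [hy j 0 ⟨le_rfl, hT.le⟩]; simp
  have hcomp : IsCompact (closure (range u)) := by
    refine BoundedContinuousFunction.arzela_ascoli (Metric.closedBall x0 (C * T))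
      (isCompact_closedBall _ _) _ ?_ ?_
    · rintro _ t ⟨j, rfl⟩
      rw [hu, Metric.mem_closedBall, ← hy0 j]
      refine ((hyL j).dist_le_mul _ _).trans ?_
      have := t.2
      rw [Real.dist_eq, sub_zero, abs_of_nonneg t.2.1]
      exact mul_le_mul_of_nonneg_left t.2.2 C.2
    · refine (LipschitzWith.uniformEquicontinuous _ C ?_).equicontinuous
      rintro ⟨_, j, rfl⟩
      exact LipschitzWith.of_dist_le_mul fun a b => (hyL j).dist_le_mul _ _
  obtain ⟨z, -, φ, hφ, hz⟩ := hcomp.tendsto_subseq (fun j => subset_closure (mem_range_self j))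
  have hzt : ∀ t : Icc (0:ℝ) T, Tendsto (fun j => y (φ j) t) atTop (𝓝 (z t)) := fun t =>
    ((continuous_eval_const t).tendsto z).comp hz
  let w : ℝ → E := fun s => z (projIcc 0 T hT.le s)
  have hw : Continuous w := z.continuous.comp continuous_projIcc
  have hGw : Continuous fun s => G s (w s) :=
    hG.comp (by fun_prop : Continuous fun s : ℝ => (s, w s))
  let x : ℝ → E := fun t => x0 + ∫ s in (0:ℝ)..t, G s (w s)
  have hxw : ∀ t ∈ Icc (0:ℝ) T, x t = w t := by
    intro t ht
    have h1 : Tendsto (fun j => y (φ j) t) atTop (𝓝 (w t)) := by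
      simpa [w, projIcc_of_mem hT.le ht] using hzt ⟨t, ht⟩
    refine tendsto_nhds_unique ?_ h1
    simp only [fun j => hy (φ j) t ht]
    refine tendsto_const_nhds.add ?_
    refine intervalIntegral.tendsto_integral_filter_of_dominated_convergence (fun _ => (C:ℝ)) ?_ ?_ ?_ ?_
    · refine Eventually.of_forall fun j => ?_
      have := (hyL (φ j)).continuous
      exact (hG.comp (by fun_prop :
        Continuous fun s : ℝ => (s, y (φ j) (max (s - 1 / ((φ j : ℝ) + 1)) 0)))).aestronglyMeasurable
    · exact Eventually.of_forall fun j => Eventually.of_forall fun s _ => hC _ _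
    · exact intervalIntegrable_const
    · refine Eventually.of_forall fun s hs => ?_
      rw [uIoc_of_le ht.1] at hs
      have hs' : s ∈ Icc (0:ℝ) T := ⟨hs.1.le, hs.2.trans ht.2⟩
      refine ((hG.tendsto (s, w s)).comp (f := fun j => (s, y (φ j) (max (s - 1 / ((φ j : ℝ) + 1)) 0)))
        (tendsto_const_nhds.prodMk_nhds ?_))
      have h2 : Tendsto (fun j => y (φ j) s) atTop (𝓝 (w s)) := by
        simpa [w, projIcc_of_mem hT.le hs'] using hzt ⟨s, hs'⟩
      refine tendsto_of_tendsto_of_dist h2 ?_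
      have h3 : Tendsto (fun j => (C:ℝ) * (1 / ((φ j : ℝ) + 1))) atTop (𝓝 0) := by
        have := (tendsto_one_div_add_atTop_nhds_zero_nat (𝕜 := ℝ)).comp hφ.tendsto_atTop
        simpa using this.const_mul (C:ℝ)
      refine squeeze_zero (fun _ => dist_nonneg) (fun j => ?_) h3
      refine ((hyL (φ j)).dist_le_mul _ _).trans (mul_le_mul_of_nonneg_left ?_ C.2)
      have hp := hδ (φ j)
      rw [Real.dist_eq, abs_le]
      rcases max_cases (s - 1 / ((φ j : ℝ) + 1)) 0 with h | h <;>
        constructor <;> linarith [hs'.1]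
  refine ⟨x, by simp [x], fun t ht => ?_⟩
  rw [hxw t ht]
  exact (intervalIntegral.integral_hasDerivAt_right (hGw.intervalIntegrable _ _)
    (hGw.stronglyMeasurableAtFilter _ _) hGw.continuousAt).const_add x0

end PeanoAux

section GeoAux

theorem aux_dist_lip (Ω : Set (Pt m)) : LipschitzWith 1 (distCl Ω) :=
  Metric.lipschitz_infDist_pt _

theorem aux_norm_grad (Ω : Set (Pt m)) (x : Pt m) : ‖gradient (distCl Ω) x‖ ≤ 1 := by
  unfold gradient
  rw [LinearIsometryEquiv.norm_map]
  simpa using norm_fderiv_le_of_lipschitz ℝ (aux_dist_lip Ω) (x₀ := x)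

theorem aux_norm_dGradd (Ω : Set (Pt m)) (x : Pt m) : ‖dGradd Ω x‖ ≤ distCl Ω x := by
  have h0 : 0 ≤ distCl Ω x := Metric.infDist_nonneg
  unfold dGradd
  split_ifs
  · simpa using h0
  · rw [norm_smul, Real.norm_of_nonneg h0]
    exact mul_le_of_le_one_right h0 (aux_norm_grad Ω x)

theorem aux_pos (Ω : Set (Pt m)) (hne : Ω.Nonempty) (x : Pt m) (hx : x ∉ closure Ω) :
    0 < distCl Ω x :=
  (isClosed_closure.notMem_iff_infDist_pos hne.closure).1 hx

theorem aux_zero (Ω : Set (Pt m)) (x : Pt m) (hx : x ∈ closure Ω) : distCl Ω x = 0 :=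
  Metric.infDist_zero_of_mem hx

theorem aux_mem_thick (Ω : Set (Pt m)) (hne : Ω.Nonempty) (ε : ℝ) (x : Pt m) :
    x ∈ Metric.thickening ε Ω ↔ distCl Ω x < ε := by
  rw [← Metric.thickening_closure, Metric.mem_thickening_iff_infDist_lt hne.closure]
  rfl

theorem aux_one_le_grad (Ω : Set (Pt m)) (hne : Ω.Nonempty) (x : Pt m) (hx : x ∉ closure Ω)
    (hd : DifferentiableAt ℝ (distCl Ω) x) : 1 ≤ ‖gradient (distCl Ω) x‖ := by
  obtain ⟨p, hp, hpd⟩ := isClosed_closure.exists_infDist_eq_dist hne.closure x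
  have hpos := aux_pos Ω hne x hx
  have hpd' : distCl Ω x = ‖p - x‖ := by rw [distCl, hpd, dist_eq_norm, norm_sub_rev]
  -- derivative along the segment to `p`
  have hl : HasDerivAt (fun s : ℝ => x + s • (p - x)) (p - x) 0 := by
    simpa using ((hasDerivAt_id (0:ℝ)).smul_const (p - x)).const_add x
  have hg : HasFDerivAt (distCl Ω) (fderiv ℝ (distCl Ω) x) (x + (0:ℝ) • (p - x)) := by
    simpa using hd.hasFDerivAt
  have h1 := (hg.comp_hasDerivAt (0:ℝ) hl).hasDerivWithinAt (s := Icc 0 1)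
  have h2 : HasDerivWithinAt (fun s : ℝ => (1 - s) * distCl Ω x) (-distCl Ω x) (Icc 0 1) 0 := by
    have := (((hasDerivAt_id (0:ℝ)).const_sub 1).mul_const (distCl Ω x)).hasDerivWithinAt (s := Icc 0 1)
    simpa using this
  have h3 : HasDerivWithinAt (fun s : ℝ => distCl Ω (x + s • (p - x)) - (1 - s) * distCl Ω x)
      (fderiv ℝ (distCl Ω) x (p - x) - -distCl Ω x) (Icc 0 1) 0 := h1.sub h2
  have h4 : ∀ s ∈ Icc (0:ℝ) 1, distCl Ω (x + s • (p - x)) ≤ (1 - s) * distCl Ω x := by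
    intro s hs
    refine (Metric.infDist_le_dist_of_mem hp).trans (le_of_eq ?_)
    rw [dist_eq_norm, show x + s • (p - x) - p = (1 - s) • (x - p) by module, norm_smul,
      Real.norm_of_nonneg (by linarith [hs.2]), hpd', norm_sub_rev]
  have h5 : fderiv ℝ (distCl Ω) x (p - x) - -distCl Ω x ≤ 0 := by
    rw [hasDerivWithinAt_iff_tendsto_slope] at h3
    have hnb : (𝓝[Icc (0:ℝ) 1 \ {0}] 0).NeBot := by
      rw [Icc_sdiff_left]
      exact left_nhdsWithin_Ioc_neBot one_pos
    refine le_of_tendsto h3 ?_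
    filter_upwards [self_mem_nhdsWithin] with s hs
    have hs0 : 0 < s := lt_of_le_of_ne hs.1.1 (fun h => hs.2 h.symm)
    rw [slope_def_field]
    refine div_nonpos_of_nonpos_of_nonneg ?_ (by linarith)
    have := h4 s hs.1
    simp only [zero_smul, add_zero]
    linarith
  have h6 : fderiv ℝ (distCl Ω) x (p - x) = ⟪gradient (distCl Ω) x, p - x⟫ := by
    unfold gradient
    rw [InnerProductSpace.toDual_symm_apply]
  have h7 := abs_real_inner_le_norm (gradient (distCl Ω) x) (p - x)
  rw [← h6, ← hpd'] at h7
  have h8 := neg_abs_le (fderiv ℝ (distCl Ω) x (p - x))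
  have : 1 * distCl Ω x ≤ ‖gradient (distCl Ω) x‖ * distCl Ω x := by linarith
  exact le_of_mul_le_mul_right this hpos

theorem aux_cont (Ω : Set (Pt m)) (hne : Ω.Nonempty) (ε : ℝ)
    (hd2 : ∀ x ∈ closure (Metric.thickening ε Ω) \ closure Ω, ContDiffAt ℝ 2 (distCl Ω) x)
    (x : Pt m) (hx : distCl Ω x < ε) : ContinuousAt (dGradd Ω) x := by
  by_cases hxc : x ∈ closure Ω
  · have h0 : dGradd Ω x = 0 := if_pos hxc
    unfold ContinuousAt
    rw [h0]
    refine squeeze_zero_norm (aux_norm_dGradd Ω) ?_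
    have := (aux_dist_lip Ω).continuous.tendsto x
    rwa [aux_zero Ω x hxc] at this
  · have hc := hd2 x ⟨subset_closure ((aux_mem_thick Ω hne ε x).2 hx), hxc⟩
    have h1 : ContinuousAt (fun y => distCl Ω y • gradient (distCl Ω) y) x := by
      refine (aux_dist_lip Ω).continuous.continuousAt.smul ?_
      unfold gradient
      exact (LinearIsometryEquiv.continuous _).continuousAt.comp
        (hc.fderiv_right (m := 1) (by norm_num)).continuousAt
    refine h1.congr ?_
    filter_upwards [isClosed_closure.isOpen_compl.mem_nhds hxc] with y hy
    exact (if_neg hy).symm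

theorem aux_bound (Ω : Set (Pt m)) (hne : Ω.Nonempty) (ε : ℝ)
    (hd2 : ∀ x ∈ closure (Metric.thickening ε Ω) \ closure Ω, ContDiffAt ℝ 2 (distCl Ω) x)
    (T M k c : ℝ) (hk : 0 < k) (hc0 : 0 < c) (hcε : c < ε) (hMc : M < k * c)
    (x x' : ℝ → Pt m) (hx0 : x 0 ∈ closure Ω)
    (hx : ∀ t ∈ Icc (0:ℝ) T, HasDerivWithinAt x (x' t) (Icc 0 T) t)
    (hx' : ∀ t ∈ Icc (0:ℝ) T, distCl Ω (x t) = c → ∃ f, ‖f‖ ≤ M ∧ x' t = f - k • dGradd Ω (x t)) :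
    ∀ t ∈ Icc (0:ℝ) T, distCl Ω (x t) ≤ c := by
  classical
  have hcont : ContinuousOn x (Icc 0 T) := fun t ht => (hx t ht).continuousWithinAt
  refine image_le_of_liminf_slope_right_lt_deriv_boundary (f := fun t => distCl Ω (x t))
    (f' := fun t => if distCl Ω (x t) = c then M - k * c else ‖x' t‖) (B := fun _ => c)
    (B' := fun _ => 0) ((aux_dist_lip Ω).continuous.comp_continuousOn hcont) ?_ ?_
    (fun _ => hasDerivAt_const _ _) ?_
  · intro t ht r hr
    have htI : t ∈ Icc (0:ℝ) T := ⟨ht.1, ht.2.le⟩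
    have hxt : HasDerivWithinAt x (x' t) (Ici t) t :=
      (hx t htI).mono_of_mem_nhdsWithin
        (mem_of_superset (Icc_mem_nhdsGE ht.2) (Icc_subset_Icc_left ht.1))
    split_ifs at hr with hcase
    · obtain ⟨f, hf, hfx⟩ := hx' t htI hcase
      have hnc : x t ∉ closure Ω := fun h => by
        rw [aux_zero Ω _ h] at hcase; exact hc0.ne hcase
      have hdiff : DifferentiableAt ℝ (distCl Ω) (x t) :=
        (hd2 _ ⟨subset_closure ((aux_mem_thick Ω hne ε _).2 (hcase ▸ hcε)), hnc⟩).differentiableAt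
          (by norm_num)
      have hD := hdiff.hasFDerivAt.comp_hasDerivWithinAt t hxt
      refine hD.liminf_right_slope_le (lt_of_le_of_lt ?_ hr)
      have h6 : fderiv ℝ (distCl Ω) (x t) (x' t) = ⟪gradient (distCl Ω) (x t), x' t⟫ := by
        unfold gradient
        rw [InnerProductSpace.toDual_symm_apply]
      have h1 := aux_one_le_grad Ω hne _ hnc hdiff
      have h2 := aux_norm_grad Ω (x t)
      have h3 : ‖gradient (distCl Ω) (x t)‖ = 1 := le_antisymm h2 h1
      have h4 : dGradd Ω (x t) = c • gradient (distCl Ω) (x t) := by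
        rw [dGradd, if_neg hnc, hcase]
      rw [h6, hfx, h4, inner_sub_right, inner_smul_right, inner_smul_right,
        real_inner_self_eq_norm_sq, h3]
      have h5 := real_inner_le_norm (gradient (distCl Ω) (x t)) f
      rw [h3, one_mul] at h5
      linarith
    · refine ((hxt.Ioi_of_Ici.limsup_norm_slope_le hr).and self_mem_nhdsWithin).frequently.mono ?_
      rintro z ⟨hz, hzt⟩
      have hzt' : 0 < z - t := sub_pos.2 hzt
      refine lt_of_le_of_lt ?_ hz
      rw [slope_def_field, Real.norm_of_nonneg hzt'.le, div_eq_inv_mul]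
      refine mul_le_mul_of_nonneg_left ?_ (by positivity)
      have := (aux_dist_lip Ω).dist_le_mul (x z) (x t)
      rw [Real.dist_eq, NNReal.coe_one, one_mul, dist_eq_norm] at this
      exact (le_abs_self _).trans this
  · simpa [aux_zero Ω _ hx0] using hc0.le
  · intro t ht hcase
    rw [if_pos hcase]
    linarith

end GeoAux

/-- **Lemma (solvability of the penalized problem and a priori bounds).**
For `k > ‖F‖_∞/ε` the penalized system
`ẋ_i^k = F_i(t,X^k) − k (d∇d)(x_i^k)`, `X^k(0) = X°`, has a classical solution
on `[0,T]`; moreover any solution satisfies `x_i^k(t) ∈ N^ε(Ω)` and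
`|ẋ_i^k(t)| ≤ 2‖F‖_∞`. -/
theorem penalized_exists_and_bounds {m n : ℕ} (Ω : Set (Pt m)) (ν : Pt m → Pt m)
    (hΩ : IsC2Domain Ω ν) (ε : ℝ) (hε : 0 < ε)
    (hd1 : ContDiffOn ℝ 2 (distCl Ω) (closure (Metric.thickening ε (frontier Ω)) \ Ω))
    (hd2 : ∀ x ∈ closure (Metric.thickening ε Ω) \ closure Ω,
      ContDiffAt ℝ 2 (distCl Ω) x)
    (T : ℝ) (hT : 0 < T) (F : Fin n → ℝ → Conf m n → Pt m)
    (hFc : ∀ i, Continuous (Function.uncurry (F i)))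
    (M : ℝ) (hM : ∀ i, ∀ t ∈ Icc (0:ℝ) T, ∀ X : Conf m n, ‖F i t X‖ ≤ M)
    (k : ℝ) (hk : M / ε < k)
    (X0 : Conf m n) (hX0 : X0 ∈ Gset Ω n) :
    (∃ X : ℝ → Conf m n, IsPenalSol Ω F T k X0 X) ∧
    (∀ X : ℝ → Conf m n, IsPenalSol Ω F T k X0 X → ∀ i, ∀ t ∈ Icc (0:ℝ) T,
      X t i ∈ Metric.thickening ε Ω ∧
      ‖F i t (X t) - k • dGradd Ω (X t i)‖ ≤ 2 * M) := by
  classical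
  have hne := hΩ.nonempty
  rcases isEmpty_or_nonempty (Fin n) with hn | ⟨⟨i0⟩⟩
  · exact ⟨⟨fun _ => X0, rfl, fun i => hn.elim i⟩, fun X _ i => hn.elim i⟩
  have hM0 : 0 ≤ M := (norm_nonneg _).trans (hM i0 0 ⟨le_rfl, hT.le⟩ X0)
  have hk0 : 0 < k := (div_nonneg hM0 hε.le).trans_lt hk
  have hMk : M / k < ε := by
    rw [div_lt_iff₀ hε] at hk
    rw [div_lt_iff₀ hk0]
    linarith
  have hMk0 : 0 ≤ M / k := div_nonneg hM0 hk0.le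
  have hlt : ∀ c, M / k < c → M < k * c := fun c hc => by
    rw [div_lt_iff₀ hk0] at hc
    linarith
  refine ⟨?_, ?_⟩
  · obtain ⟨c0, hc0, hc0ε⟩ := exists_between hMk
    obtain ⟨c1, hc01, hc1ε⟩ := exists_between hc0ε
    have hc0p : 0 < c0 := hMk0.trans_lt hc0
    have hdc := (aux_dist_lip Ω).continuous
    let φ : ℝ → ℝ := fun r => max 0 (min 1 ((c1 - r) / (c1 - c0)))
    have hφc : Continuous φ := by fun_prop
    have hφ0 : ∀ r, 0 ≤ φ r := fun r => le_max_left _ _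
    have hφ1 : ∀ r, φ r ≤ 1 := fun r => max_le zero_le_one (min_le_left _ _)
    have hφz : ∀ r, c1 ≤ r → φ r = 0 := fun r hr =>
      max_eq_left ((min_le_right _ _).trans
        (div_nonpos_of_nonpos_of_nonneg (by linarith) (by linarith)))
    have hφo : ∀ r, r ≤ c0 → φ r = 1 := fun r hr => by
      have : 1 ≤ (c1 - r) / (c1 - c0) := by
        rw [le_div_iff₀ (by linarith)]
        linarith
      simp [φ, min_eq_left this]
    let b : Pt m → Pt m := fun x => φ (distCl Ω x) • dGradd Ω x
    have hb : Continuous b := by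
      rw [continuous_iff_continuousAt]
      intro x
      by_cases hx : distCl Ω x < ε
      · exact (hφc.comp hdc).continuousAt.smul (aux_cont Ω hne ε hd2 x hx)
      · have h1 : c1 < distCl Ω x := hc1ε.trans_le (not_lt.1 hx)
        refine (continuousAt_const (y := (0 : Pt m))).congr ?_
        filter_upwards [hdc.continuousAt.eventually (lt_mem_nhds h1)] with y hy
        simp [b, hφz _ hy.le]
    have hbn : ∀ x, ‖b x‖ ≤ c1 := by
      intro x
      rcases le_total c1 (distCl Ω x) with h | h
      · simp only [b, hφz _ h, zero_smul, norm_zero]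
        linarith
      · simp only [b]
        rw [norm_smul, Real.norm_of_nonneg (hφ0 _)]
        exact (mul_le_of_le_one_left (norm_nonneg _) (hφ1 _)).trans ((aux_norm_dGradd Ω x).trans h)
    let G : ℝ → Conf m n → Conf m n := fun t X i =>
      F i (projIcc 0 T hT.le t) X - k • b (X i)
    have hG : Continuous (Function.uncurry G) := by
      refine continuous_pi fun i => ?_
      have h1 : Continuous fun p : ℝ × Conf m n => (((projIcc 0 T hT.le p.1 : Icc (0:ℝ) T) : ℝ), p.2) :=
        (continuous_subtype_val.comp (continuous_projIcc.comp continuous_fst)).prodMk continuous_snd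
      have h2 : Continuous fun p : ℝ × Conf m n => b (p.2 i) :=
        hb.comp ((continuous_apply i).comp continuous_snd)
      exact ((hFc i).comp h1).sub (h2.const_smul k)
    have hC0 : 0 ≤ M + k * c1 := by
      have : 0 < c1 := hc0p.trans hc01
      positivity
    have hGb : ∀ t X, ‖G t X‖ ≤ ((⟨M + k * c1, hC0⟩ : ℝ≥0) : ℝ) := by
      intro t X
      rw [pi_norm_le_iff_of_nonneg hC0]
      intro i
      refine (norm_sub_le _ _).trans (add_le_add (hM i _ (projIcc 0 T hT.le t).2 X) ?_)
      rw [norm_smul, Real.norm_of_nonneg hk0.le]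
      exact mul_le_mul_of_nonneg_left (hbn _) hk0.le
    obtain ⟨X, hX0', hX⟩ := aux_peano G hG _ hGb X0 T hT
    have hXi : ∀ i, ∀ t ∈ Icc (0:ℝ) T,
        HasDerivWithinAt (fun s => X s i) (F i t (X t) - k • b (X t i)) (Icc 0 T) t := by
      intro i t ht
      have := (hasDerivAt_pi.1 (hX t ht) i).hasDerivWithinAt (s := Icc 0 T)
      simpa [G, projIcc_of_mem hT.le ht] using this
    refine ⟨X, hX0', fun i t ht => ?_⟩
    have hbd := aux_bound Ω hne ε hd2 T M k c0 hk0 hc0p hc0ε (hlt _ hc0) (fun s => X s i)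
      (fun s => F i s (X s) - k • b (X s i)) (by rw [hX0']; exact hX0 i) (hXi i)
      (fun s hs hsc => ⟨F i s (X s), hM i s hs _, by
        simp only [b]
        rw [hφo _ hsc.le, one_smul]⟩) t ht
    have h := hXi i t ht
    have hbe : b (X t i) = dGradd Ω (X t i) := by
      simp only [b]
      rw [hφo _ hbd, one_smul]
    rwa [hbe] at h
  · intro X hX i t ht
    have hle : distCl Ω (X t i) ≤ M / k := by
      refine le_of_forall_gt_imp_ge_of_dense fun c hc => ?_
      rcases lt_or_ge c ε with hcε | hcε
      · exact aux_bound Ω hne ε hd2 T M k c hk0 (hMk0.trans_lt hc) hcε (hlt c hc)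
          (fun s => X s i) (fun s => F i s (X s) - k • dGradd Ω (X s i))
          (by rw [hX.1]; exact hX0 i) (hX.2 i)
          (fun s hs _ => ⟨F i s (X s), hM i s hs _, rfl⟩) t ht
      · obtain ⟨c', hc', hc'ε⟩ := exists_between hMk
        exact (aux_bound Ω hne ε hd2 T M k c' hk0 (hMk0.trans_lt hc') hc'ε (hlt c' hc')
          (fun s => X s i) (fun s => F i s (X s) - k • dGradd Ω (X s i))
          (by rw [hX.1]; exact hX0 i) (hX.2 i)
          (fun s hs _ => ⟨F i s (X s), hM i s hs _, rfl⟩) t ht).trans (hc'ε.le.trans hcε)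
    refine ⟨(aux_mem_thick Ω hne ε _).2 (hle.trans_lt hMk), ?_⟩
    have h1 : ‖k • dGradd Ω (X t i)‖ ≤ M := by
      rw [norm_smul, Real.norm_of_nonneg hk0.le]
      have h2 := (aux_norm_dGradd Ω (X t i)).trans hle
      rw [le_div_iff₀ hk0] at h2
      linarith
    linarith [norm_sub_le (F i t (X t)) (k • dGradd Ω (X t i)), hM i t ht (X t)]
end
end

section
/- Let X^k = {x_i^k} be a classical solution of the penalized system ẋ_i^k(t) = F_i(t, X^k(t)) − k(d∇d)(x_i^k(t)) with k > ‖F‖_∞/ε. Suppose that for some index i and some interval [t₀, t₁] ⊂ [0,T] one has x_i^k(t₀) ∈ ∂Ω and x_i^k(t) ∈ N^ε(Ω) \ cl Ω for all t₀ < t < t₁. Then for all t ∈ (t₀, t₁]: d(x_i^k(t)) ≤ ‖F‖_∞(1 − e^{−k(t−t₀)})/k ≤ ‖F‖_∞/k < ε. -/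
open Set MeasureTheory Filter
open scoped RealInnerProductSpace Topology NNReal ContDiff

noncomputable section

variable {m n : ℕ}

/-- At a point of differentiability outside `cl Ω`, the distance has unit gradient. -/
lemma norm_grad_distCl {m : ℕ} (Ω : Set (Pt m)) (hne : Ω.Nonempty) (x : Pt m)
    (hx : x ∉ closure Ω) (hd : DifferentiableAt ℝ (distCl Ω) x) :
    ‖gradient (distCl Ω) x‖ = 1 := by
  have hg : HasFDerivAt (distCl Ω) (InnerProductSpace.toDual ℝ (Pt m) (gradient (distCl Ω) x)) x :=
    hd.hasGradientAt.hasFDerivAt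
  have hlip : LipschitzWith 1 (distCl Ω) := Metric.lipschitz_infDist_pt _
  have hle : ‖gradient (distCl Ω) x‖ ≤ 1 := by
    have := hg.le_of_lipschitz hlip
    rw [LinearIsometryEquiv.norm_map] at this
    exact_mod_cast this
  obtain ⟨p, hp, hpd⟩ := isClosed_closure.exists_infDist_eq_dist (hne.closure) x
  have hpd' : distCl Ω x = ‖p - x‖ := by
    rw [distCl, hpd, dist_comm, dist_eq_norm]
  have hpos : 0 < ‖p - x‖ := by
    rw [norm_pos_iff, sub_ne_zero]
    rintro rfl
    exact hx hp
  have hcurve : HasDerivAt (fun s : ℝ => x + s • (p - x)) (p - x) 0 := by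
    simpa using ((hasDerivAt_id (0:ℝ)).smul_const (p - x)).const_add x
  have hcomp : HasDerivAt (fun s : ℝ => distCl Ω (x + s • (p - x)))
      (⟪gradient (distCl Ω) x, p - x⟫) 0 := by
    have h0 : HasFDerivAt (distCl Ω)
      (InnerProductSpace.toDual ℝ (Pt m) (gradient (distCl Ω) x)) (x + (0:ℝ) • (p - x)) := by
      simpa using hg
    have h1 := h0.comp_hasDerivAt (0:ℝ) hcurve
    rw [InnerProductSpace.toDual_apply_apply] at h1
    exact h1
  have hlin : HasDerivAt (fun s : ℝ => (1 - s) * ‖p - x‖) (-‖p - x‖) 0 := by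
    simpa using ((hasDerivAt_id (0:ℝ)).const_sub 1).mul_const ‖p - x‖
  have hev : ∀ s ∈ Icc (0:ℝ) 1, distCl Ω (x + s • (p - x)) = (1 - s) * ‖p - x‖ := by
    intro s hs
    apply le_antisymm
    · refine (Metric.infDist_le_dist_of_mem hp).trans_eq ?_
      rw [dist_eq_norm, show x + s • (p - x) - p = -((1 - s) • (p - x)) by module, norm_neg,
        norm_smul, Real.norm_of_nonneg (by linarith [hs.2])]
    · have h := hlip.dist_le_mul x (x + s • (p - x))
      rw [Real.dist_eq, dist_eq_norm, show x - (x + s • (p - x)) = -(s • (p - x)) by module,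
        norm_neg, norm_smul, Real.norm_of_nonneg hs.1, hpd'] at h
      have := le_abs_self (‖p - x‖ - distCl Ω (x + s • (p - x)))
      simp only [NNReal.coe_one, one_mul] at h
      linarith
  have heq : ⟪gradient (distCl Ω) x, p - x⟫ = -‖p - x‖ := by
    have h1 := hcomp.hasDerivWithinAt (s := Icc (0:ℝ) 1)
    have h2 := (hlin.hasDerivWithinAt (s := Icc (0:ℝ) 1)).congr hev (hev 0 (by simp))
    exact (uniqueDiffOn_Icc (zero_lt_one) 0 (by simp)).eq_deriv _ h1 h2
  have hcs := abs_real_inner_le_norm (gradient (distCl Ω) x) (p - x)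
  rw [heq, abs_neg, abs_norm] at hcs
  apply le_antisymm hle
  by_contra! hlt
  nlinarith

/-- **Lemma (distance estimate for excursions of penalized solutions).**
If a penalized solution leaves `cl Ω` at time `t₀` through `∂Ω` and stays in
`N^ε(Ω) \ cl Ω` on `(t₀,t₁)`, then
`d(x_i^k(t)) ≤ ‖F‖_∞ (1 − e^{−k(t−t₀)})/k ≤ ‖F‖_∞/k < ε` on `(t₀,t₁]`. -/
theorem penalized_excursion_bound {m n : ℕ} (Ω : Set (Pt m)) (ν : Pt m → Pt m)
    (hΩ : IsC2Domain Ω ν) (ε : ℝ) (hε : 0 < ε)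
    (hd1 : ContDiffOn ℝ 2 (distCl Ω) (closure (Metric.thickening ε (frontier Ω)) \ Ω))
    (hd2 : ∀ x ∈ closure (Metric.thickening ε Ω) \ closure Ω,
      ContDiffAt ℝ 2 (distCl Ω) x)
    (T : ℝ) (F : Fin n → ℝ → Conf m n → Pt m)
    (hFc : ∀ i, Continuous (Function.uncurry (F i)))
    (M : ℝ) (hM : ∀ i, ∀ t ∈ Icc (0:ℝ) T, ∀ X : Conf m n, ‖F i t X‖ ≤ M)
    (k : ℝ) (hk : M / ε < k)
    (X0 : Conf m n) (hX0 : X0 ∈ Gset Ω n)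
    (X : ℝ → Conf m n) (hsol : IsPenalSol Ω F T k X0 X)
    (i : Fin n) (t₀ t₁ : ℝ) (ht₀ : 0 ≤ t₀) (ht01 : t₀ < t₁) (ht₁ : t₁ ≤ T)
    (hbdry : X t₀ i ∈ frontier Ω)
    (hout : ∀ t ∈ Ioo t₀ t₁, X t i ∈ Metric.thickening ε Ω \ closure Ω) :
    ∀ t ∈ Ioc t₀ t₁,
      distCl Ω (X t i) ≤ M * (1 - Real.exp (-k * (t - t₀))) / k ∧
      M * (1 - Real.exp (-k * (t - t₀))) / k ≤ M / k ∧
      M / k < ε := by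
  have ht₀T : t₀ ∈ Icc (0:ℝ) T := ⟨ht₀, by linarith⟩
  have hM0 : 0 ≤ M := (norm_nonneg _).trans (hM i t₀ ht₀T (X t₀))
  have hk0 : 0 < k := lt_of_le_of_lt (by positivity) hk
  have hMk : M / k < ε := by
    rw [div_lt_iff₀ hε] at hk
    rw [div_lt_iff₀ hk0]
    linarith
  have hlip : LipschitzWith 1 (distCl Ω) := Metric.lipschitz_infDist_pt _
  have hder : ∀ t ∈ Ioo t₀ t₁, ∃ g', HasDerivAt (fun s => distCl Ω (X s i)) g' t ∧
      g' ≤ M - k * distCl Ω (X t i) := by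
    intro t ht
    have htT : t ∈ Icc (0:ℝ) T := ⟨by linarith [ht.1], by linarith [ht.2]⟩
    obtain ⟨h1, h2⟩ := hout t ht
    have hdiff : DifferentiableAt ℝ (distCl Ω) (X t i) :=
      (hd2 _ ⟨subset_closure h1, h2⟩).differentiableAt (by norm_num)
    have hn := norm_grad_distCl Ω hΩ.nonempty _ h2 hdiff
    have hx := (hsol.2 i t htT).hasDerivAt
      (Icc_mem_nhds (by linarith [ht.1]) (by linarith [ht.2]))
    have hc := HasFDerivAt.comp_hasDerivAt (f := fun s => X s i) t
      hdiff.hasGradientAt.hasFDerivAt hx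
    refine ⟨_, hc, ?_⟩
    rw [InnerProductSpace.toDual_apply_apply, dGradd, if_neg h2, inner_sub_right,
      inner_smul_right, inner_smul_right, real_inner_self_eq_norm_sq, hn]
    have h3 := real_inner_le_norm (gradient (distCl Ω) (X t i)) (F i t (X t))
    rw [hn] at h3
    have h4 := hM i t htT (X t)
    linarith
  have hcont : ContinuousOn (fun s => X s i) (Icc t₀ t₁) := fun t ht =>
    ((hsol.2 i t ⟨by linarith [ht.1], by linarith [ht.2]⟩).continuousWithinAt).mono
      (Icc_subset_Icc ht₀ ht₁)
  have hexp : ∀ t, HasDerivAt (fun s => Real.exp (k * (s - t₀)))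
      (Real.exp (k * (t - t₀)) * k) t := by
    intro t
    have := (((hasDerivAt_id t).sub_const t₀).const_mul k).exp
    simpa using this
  have hanti : AntitoneOn
      (fun s => Real.exp (k * (s - t₀)) * (distCl Ω (X s i) - M / k)) (Icc t₀ t₁) := by
    apply antitoneOn_of_deriv_nonpos (convex_Icc _ _)
    · exact (Continuous.continuousOn (by fun_prop)).mul
        ((hlip.continuous.comp_continuousOn hcont).sub continuousOn_const)
    · rw [interior_Icc]
      intro t ht
      obtain ⟨g', hg, -⟩ := hder t ht
      exact ((hexp t).mul (hg.sub_const (M / k))).differentiableAt.differentiableWithinAt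
    · rw [interior_Icc]
      intro t ht
      obtain ⟨g', hg, hle⟩ := hder t ht
      have hD := ((hexp t).mul (hg.sub_const (M / k))).deriv
      refine (show _ = _ from hD).trans_le ?_
      have he := Real.exp_pos (k * (t - t₀))
      have : k * (M / k) = M := by field_simp
      have h5 : Real.exp (k * (t - t₀)) * k * (distCl Ω (X t i) - M / k)
          + Real.exp (k * (t - t₀)) * g'
          = Real.exp (k * (t - t₀)) * (k * distCl Ω (X t i) - k * (M / k) + g') := by ring
      rw [h5, this]
      exact mul_nonpos_of_nonneg_of_nonpos he.le (by linarith)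
  intro t ht
  refine ⟨?_, ?_, hMk⟩
  · have h := hanti (left_mem_Icc.2 ht01.le) (Ioc_subset_Icc_self ht) ht.1.le
    have hz : distCl Ω (X t₀ i) = 0 :=
      Metric.infDist_zero_of_mem (frontier_subset_closure hbdry)
    simp only [hz, sub_self, mul_zero, Real.exp_zero, one_mul, zero_sub] at h
    have he := Real.exp_pos (-k * (t - t₀))
    have hee : Real.exp (-k * (t - t₀)) * Real.exp (k * (t - t₀)) = 1 := by
      rw [← Real.exp_add]; simp
    have h6 := mul_le_mul_of_nonneg_left h he.le
    rw [← mul_assoc, hee, one_mul] at h6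
    have h7 : M * (1 - Real.exp (-k * (t - t₀))) / k
        = M / k - Real.exp (-k * (t - t₀)) * (M / k) := by ring
    rw [h7]
    linarith
  · have he := Real.exp_pos (-k * (t - t₀))
    gcongr
    nlinarith
end
end

section
/- Let X° ∈ G and for each k ≥ k₀ (where k₀ > ‖F‖_∞/ε) let X^k = {x_i^k} be a classical solution on [0,T] of the penalized system ẋ_i^k(t) = F_i(t, X^k(t)) − k(d∇d)(x_i^k(t)), x_i^k(0) = x_i°. Then there exist a subsequence (not relabelled) and X = {x_i} ∈ W^{1,∞}(0,T;(ℝ^m)^n) ∩ C⁰([0,T]; G) such that, for every i = 1,…,n, x_i^k → x_i strongly in C⁰([0,T]; ℝ^m) and ẋ_i^k ⇀ ẋ_i weakly-* in L^∞(0,T; ℝ^m) as k → ∞. -/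
open Set MeasureTheory Filter
open scoped RealInnerProductSpace Topology NNReal ContDiff

noncomputable section

variable {m n : ℕ}

theorem pc_scalar_parts {C : ℝ≥0} {f g : ℝ → ℝ} (hf : LipschitzWith C f)
    (hgc : HasCompactSupport g) (hg : ContDiff ℝ ∞ g) :
    ∫ x, deriv f x * g x = ∫ x, -(deriv g x) * f x := by
  obtain ⟨D, hD⟩ := ContDiff.lipschitzWith_of_hasCompactSupport hgc hg (by simp)
  have := LipschitzWith.integral_lineDeriv_mul_eq (μ := volume) hf hD hgc 1
  have e1 : ∀ x, lineDeriv ℝ f x 1 = deriv f x := fun x => by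
    simp only [lineDeriv, smul_eq_mul, mul_one]
    simpa using deriv_comp_const_add f x 0
  have e2 : ∀ x, lineDeriv ℝ g x (-1) = -deriv g x := fun x => by
    have hd : DifferentiableAt ℝ g x := (hg.differentiable (by simp)).differentiableAt
    rw [hd.lineDeriv_eq_fderiv, map_neg]
    simp
  simpa only [e1, e2] using this

theorem pc_scalar_weak {C : ℝ≥0} {f : ℕ → ℝ → ℝ} {f0 ψ : ℝ → ℝ} (hf : ∀ k, LipschitzWith C (f k))
    (hf0 : LipschitzWith C f0) (hlim : ∀ x, Tendsto (fun k => f k x) atTop (𝓝 (f0 x)))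
    (hψ : Integrable ψ) :
    Tendsto (fun k => ∫ x, deriv (f k) x * ψ x) atTop (𝓝 (∫ x, deriv f0 x * ψ x)) := by
  have hsm : ∀ g : ℝ → ℝ, HasCompactSupport g → ContDiff ℝ ∞ g →
      Tendsto (fun k => ∫ x, deriv (f k) x * g x) atTop (𝓝 (∫ x, deriv f0 x * g x)) := by
    intro g hgc hg
    simp_rw [fun k => pc_scalar_parts (hf k) hgc hg, pc_scalar_parts hf0 hgc hg]
    obtain ⟨B, hB⟩ := (hlim 0).norm.bddAbove_range
    have hgd : Continuous (deriv g) := hg.continuous_deriv (by simp)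
    refine tendsto_integral_of_dominated_convergence (fun x => ‖deriv g x‖ * (B + C * |x|)) ?_ ?_ ?_ ?_
    · intro k
      exact (hgd.neg.mul (hf k).continuous).aestronglyMeasurable
    · refine Continuous.integrable_of_hasCompactSupport (by fun_prop) ?_
      exact hgc.deriv.norm.mul_right
    · intro k
      refine Eventually.of_forall fun x => ?_
      rw [norm_mul, norm_neg]
      gcongr
      have h1 := (hf k).dist_le_mul x 0
      have h2 : ‖f k 0‖ ≤ B := hB ⟨k, rfl⟩
      rw [dist_eq_norm, dist_eq_norm, sub_zero, Real.norm_eq_abs x] at h1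
      have h3 := norm_le_norm_add_norm_sub' (f k x) (f k 0)
      linarith
    · exact Eventually.of_forall fun x => (hlim x).const_mul _
  have hb : ∀ h : ℝ → ℝ, LipschitzWith C h → ∀ x, ‖deriv h x‖ ≤ C :=
    fun h hh x => norm_deriv_le_of_lipschitz hh
  have hint : ∀ h : ℝ → ℝ, LipschitzWith C h → ∀ p : ℝ → ℝ, Integrable p →
      Integrable (fun x => deriv h x * p x) := fun h hh p hp =>
    hp.bdd_mul (measurable_deriv h).aestronglyMeasurable (Eventually.of_forall (hb h hh))
  rw [Metric.tendsto_atTop]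
  intro η hη
  have hη' : 0 < η / (3 * (C + 1)) := by positivity
  obtain ⟨g, hgc, hg, hψg⟩ := (memLp_one_iff_integrable.2 hψ).exist_eLpNorm_sub_le
    (by simp) le_rfl hη'
  have hgi : Integrable g := hg.continuous.integrable_of_hasCompactSupport hgc
  have hL1 : ∫ x, ‖ψ x - g x‖ ≤ η / (3 * (C + 1)) := by
    rw [eLpNorm_one_eq_lintegral_enorm] at hψg
    have e := integral_norm_eq_lintegral_enorm (hψ.sub hgi).aestronglyMeasurable
    simp only [Pi.sub_apply] at e hψg
    rw [e]
    exact ENNReal.toReal_le_of_le_ofReal hη'.le hψg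
  have hclose : ∀ h : ℝ → ℝ, LipschitzWith C h →
      |(∫ x, deriv h x * ψ x) - ∫ x, deriv h x * g x| ≤ η / 3 := by
    intro h hh
    rw [← integral_sub (hint h hh _ hψ) (hint h hh _ hgi), ← Real.norm_eq_abs]
    calc ‖∫ x, (deriv h x * ψ x - deriv h x * g x)‖
        ≤ ∫ x, C * ‖ψ x - g x‖ := by
          refine norm_integral_le_of_norm_le ((hψ.sub hgi).norm.const_mul _) ?_
          refine Eventually.of_forall fun x => ?_
          rw [← mul_sub, norm_mul]
          exact mul_le_mul_of_nonneg_right (hb h hh x) (norm_nonneg _)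
      _ ≤ C * (η / (3 * (C + 1))) := by
          rw [integral_const_mul]
          exact mul_le_mul_of_nonneg_left hL1 C.2
      _ ≤ η / 3 := by
          rw [mul_div_assoc', div_le_div_iff₀ (by positivity) (by norm_num)]
          nlinarith [C.2]
  obtain ⟨N, hN⟩ := (Metric.tendsto_atTop.1 (hsm g hgc hg)) (η / 3) (by positivity)
  refine ⟨N, fun k hk => ?_⟩
  have a1 := abs_le.1 (hclose _ (hf k))
  have a2 := abs_le.1 (hclose _ hf0)
  have a3 := hN k hk
  rw [Real.dist_eq, abs_lt] at a3 ⊢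
  constructor <;> linarith [a1.1, a1.2, a2.1, a2.2, a3.1, a3.2]

theorem pc_vec_weak {m : ℕ} {C : ℝ≥0} {f : ℕ → ℝ → Pt m} {f0 : ℝ → Pt m} {S : Set ℝ}
    (hS : MeasurableSet S) {ψ : ℝ → Pt m}
    (hf : ∀ k, LipschitzWith C (f k))
    (hf0 : LipschitzWith C f0) (hlim : ∀ x, Tendsto (fun k => f k x) atTop (𝓝 (f0 x)))
    (hψ : IntegrableOn ψ S) :
    Tendsto (fun k => ∫ x in S, ⟪deriv (f k) x, ψ x⟫) atTop
      (𝓝 (∫ x in S, ⟪deriv f0 x, ψ x⟫)) := by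
  have hψ1 : ∀ j, Integrable (S.indicator (fun x => ψ x j)) := fun j => by
    rw [integrable_indicator_iff hS]
    exact (EuclideanSpace.proj (𝕜 := ℝ) j).integrable_comp hψ
  have hc : ∀ h : ℝ → Pt m, LipschitzWith C h → ∀ j, LipschitzWith C (fun x => h x j) := by
    intro h hh j
    refine LipschitzWith.of_dist_le_mul fun x y => ?_
    refine le_trans ?_ (hh.dist_le_mul x y)
    rw [dist_eq_norm, dist_eq_norm]
    exact PiLp.norm_apply_le (h x - h y) j
  have key : ∀ h : ℝ → Pt m, LipschitzWith C h → ∫ x in S, ⟪deriv h x, ψ x⟫ =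
      ∑ j, ∫ x, deriv (fun x => h x j) x * S.indicator (fun x => ψ x j) x := by
    intro h hh
    rw [← integral_finsetSum]
    · rw [← integral_indicator hS]
      refine integral_congr_ae ?_
      filter_upwards [hh.ae_differentiableAt_real] with x hx
      have hd : ∀ j, deriv (fun x => h x j) x = deriv h x j := fun j =>
        ((EuclideanSpace.proj (𝕜 := ℝ) j).hasFDerivAt.comp_hasDerivAt x hx.hasDerivAt).deriv
      by_cases hxS : x ∈ S
      · simp only [Set.indicator_of_mem hxS, hd, PiLp.inner_apply]
        refine Finset.sum_congr rfl fun j _ => ?_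
        simp [mul_comm]
      · simp [Set.indicator_of_notMem hxS]
    · intro j _
      exact (hψ1 j).bdd_mul (measurable_deriv _).aestronglyMeasurable
        (Eventually.of_forall fun x => norm_deriv_le_of_lipschitz (hc h hh j))
  simp_rw [fun k => key _ (hf k), key _ hf0]
  refine tendsto_finsetSum _ fun j _ => ?_
  exact pc_scalar_weak (fun k => hc _ (hf k) j) (hc _ hf0 j)
    (fun x => ((EuclideanSpace.proj (𝕜 := ℝ) j).continuous.tendsto _).comp (hlim x)) (hψ1 j)

theorem pc_norm_grad_le {m : ℕ} (Ω : Set (Pt m)) (x : Pt m) : ‖gradient (distCl Ω) x‖ ≤ 1 := by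
  rw [gradient, LinearIsometryEquiv.norm_map]
  exact norm_fderiv_le_of_lipschitz (C := 1) ℝ (Metric.lipschitz_infDist_pt (closure Ω))

theorem pc_one_le_norm_grad {m : ℕ} {Ω : Set (Pt m)} (hne : Ω.Nonempty) {x : Pt m}
    (hx : x ∉ closure Ω) (hd : DifferentiableAt ℝ (distCl Ω) x) :
    1 ≤ ‖gradient (distCl Ω) x‖ := by
  obtain ⟨p, hp, hpd⟩ := isClosed_closure.exists_infDist_eq_dist hne.closure x
  have hpos : 0 < distCl Ω x := by
    refine lt_of_le_of_ne Metric.infDist_nonneg fun h => hx ?_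
    rw [← closure_closure]
    exact (Metric.mem_closure_iff_infDist_zero hne.closure).2 h.symm
  have hD : distCl Ω x = ‖x - p‖ := by rw [← dist_eq_norm]; exact hpd
  have h1 : HasDerivAt (fun s : ℝ => distCl Ω (x + s • (p - x)))
      ⟪gradient (distCl Ω) x, p - x⟫ 0 := by
    have hg := hd.hasGradientAt.hasFDerivAt
    have hl : HasDerivAt (fun s : ℝ => x + s • (p - x)) (p - x) 0 := by
      simpa using ((hasDerivAt_id (0:ℝ)).smul_const (p - x)).const_add x
    have := HasFDerivAt.comp_hasDerivAt (0:ℝ) (l := distCl Ω)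
      (f := fun s : ℝ => x + s • (p - x)) (by rw [zero_smul, add_zero]; exact hg) hl
    exact this
  have h2 : HasDerivAt (fun s : ℝ => distCl Ω (x + s • (p - x)) - (1 - s) * distCl Ω x)
      (⟪gradient (distCl Ω) x, p - x⟫ + distCl Ω x) 0 := by
    have := h1.sub ((((hasDerivAt_id (0:ℝ)).const_sub 1)).mul_const (distCl Ω x))
    refine HasDerivAt.congr_deriv this ?_
    ring
  have h3 : ⟪gradient (distCl Ω) x, p - x⟫ + distCl Ω x ≤ 0 := by
    by_contra! hcon
    have h4 := h2.hasDerivWithinAt (s := Ioi 0)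
    rw [hasDerivWithinAt_iff_tendsto_slope' (by simp)] at h4
    have h5 := h4.eventually (lt_mem_nhds hcon)
    have h6 : ∀ᶠ s : ℝ in 𝓝[>] 0, s ∈ Ioo (0:ℝ) 1 := Ioo_mem_nhdsGT one_pos
    obtain ⟨s, hs, hs'⟩ := (h5.and h6).exists
    rw [slope_def_field] at hs
    have h7 : distCl Ω (x + s • (p - x)) ≤ (1 - s) * distCl Ω x := by
      refine (Metric.infDist_le_dist_of_mem hp).trans ?_
      rw [hD, dist_eq_norm]
      have : x + s • (p - x) - p = (1 - s) • (x - p) := by module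
      rw [this, norm_smul, Real.norm_of_nonneg (by linarith [hs'.2])]
    have h8 : (distCl Ω (x + s • (p - x)) - (1 - s) * distCl Ω x -
        (distCl Ω (x + (0:ℝ) • (p - x)) - (1 - 0) * distCl Ω x)) / (s - 0) ≤ 0 := by
      apply div_nonpos_of_nonpos_of_nonneg
      · simp; linarith
      · linarith [hs'.1]
    linarith
  have h9 := abs_real_inner_le_norm (gradient (distCl Ω) x) (p - x)
  rw [norm_sub_rev p x, ← hD] at h9
  have h10 := (abs_le.1 h9).1
  nlinarith

/-- a priori bound -/
theorem pc_dist_bound {m n : ℕ} {Ω : Set (Pt m)} (hne : Ω.Nonempty) {ε : ℝ}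
    (hd2 : ∀ x ∈ closure (Metric.thickening ε Ω) \ closure Ω,
      ContDiffAt ℝ 2 (distCl Ω) x)
    {T : ℝ} {F : Fin n → ℝ → Conf m n → Pt m}
    {M : ℝ} (hM : ∀ i, ∀ t ∈ Icc (0:ℝ) T, ∀ X : Conf m n, ‖F i t X‖ ≤ M)
    {k : ℝ} (hk : 0 < k) (hkM : M / k < ε) (hM0 : 0 ≤ M)
    {X0 : Conf m n} (hX0 : X0 ∈ Gset Ω n) {X : ℝ → Conf m n}
    (hsol : IsPenalSol Ω F T k X0 X) (i : Fin n) :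
    ∀ t ∈ Icc (0:ℝ) T, distCl Ω (X t i) ≤ M / k := by
  have hlip : LipschitzWith 1 (distCl Ω) := Metric.lipschitz_infDist_pt (closure Ω)
  have hcont : ContinuousOn (fun t => distCl Ω (X t i)) (Icc 0 T) :=
    hlip.continuous.comp_continuousOn fun t ht => (hsol.2 i t ht).continuousWithinAt
  have main : ∀ c, M / k < c → c < ε → Icc (0:ℝ) T ⊆ {t | distCl Ω (X t i) ≤ c} := by
    intro c hc hcε
    have hc0 : 0 < c := lt_of_le_of_lt (by positivity) hc
    apply IsClosed.Icc_subset_of_forall_mem_nhdsWithin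
    · rw [inter_comm]
      exact hcont.preimage_isClosed_of_isClosed isClosed_Icc isClosed_Iic
    · have : distCl Ω (X 0 i) = 0 := by
        rw [hsol.1]
        exact Metric.infDist_zero_of_mem (hX0 i)
      change distCl Ω (X 0 i) ≤ c
      rw [this]
      exact hc0.le
    · rintro t ⟨htc, ht⟩
      have htI : t ∈ Icc 0 T := Ico_subset_Icc_self ht
      have hnb : 𝓝[>] t ≤ 𝓝[Icc 0 T] t := by
        rw [← nhdsWithin_Ioc_eq_nhdsGT ht.2]
        exact nhdsWithin_mono _ fun s hs => ⟨ht.1.trans hs.1.le, hs.2⟩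
      rcases lt_or_eq_of_le (show distCl Ω (X t i) ≤ c from htc) with hlt | heq
      · have := (hcont t htI).eventually (gt_mem_nhds hlt)
        filter_upwards [hnb this] with s hs using le_of_lt hs
      · have hx : X t i ∉ closure Ω := fun h => by
          have : distCl Ω (X t i) = 0 := Metric.infDist_zero_of_mem h
          linarith
        have hth : X t i ∈ Metric.thickening ε Ω := by
          rw [Metric.mem_thickening_iff_infDist_lt hne, ← Metric.infDist_closure]
          exact heq.trans_lt hcε
        have hdiff : DifferentiableAt ℝ (distCl Ω) (X t i) :=
          (hd2 _ ⟨subset_closure hth, hx⟩).differentiableAt (by norm_num)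
        set u := gradient (distCl Ω) (X t i) with hu
        have hu1 : ‖u‖ = 1 := le_antisymm (pc_norm_grad_le _ _) (pc_one_le_norm_grad hne hx hdiff)
        have hder : HasDerivWithinAt (fun s => distCl Ω (X s i))
            (⟪u, F i t (X t) - k • dGradd Ω (X t i)⟫) (Icc 0 T) t := by
          have := (hdiff.hasGradientAt.hasFDerivAt).comp_hasDerivWithinAt t (hsol.2 i t htI)
          exact this
        have hneg : ⟪u, F i t (X t) - k • dGradd Ω (X t i)⟫ < 0 := by
          rw [dGradd, if_neg hx, ← hu, heq, inner_sub_right, inner_smul_right, inner_smul_right,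
            real_inner_self_eq_norm_sq, hu1]
          have h1 := real_inner_le_norm u (F i t (X t))
          rw [hu1, one_mul] at h1
          have h2 := hM i t htI (X t)
          have h3 : M < c * k := (div_lt_iff₀ hk).1 hc
          linarith
        have h4 : HasDerivWithinAt (fun s => distCl Ω (X s i))
            (⟪u, F i t (X t) - k • dGradd Ω (X t i)⟫) (Ioi t) t :=
          hder.mono_of_mem_nhdsWithin (hnb self_mem_nhdsWithin)
        rw [hasDerivWithinAt_iff_tendsto_slope' (by simp)] at h4
        filter_upwards [h4.eventually (gt_mem_nhds hneg), self_mem_nhdsWithin] with s hs hts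
        have hts' : 0 < s - t := sub_pos.2 hts
        rw [slope_def_field, div_lt_iff₀ hts'] at hs
        change distCl Ω (X s i) ≤ c
        linarith
  intro t ht
  by_contra! hcon
  obtain ⟨c, hc1, hc2⟩ := exists_between (lt_min hcon hkM)
  have := main c hc1 (hc2.trans_le (min_le_right _ _)) ht
  have h2 := hc2.trans_le (min_le_left _ _)
  replace this : distCl Ω (X t i) ≤ c := this
  linarith

theorem pc_vel_bound {m n : ℕ} {Ω : Set (Pt m)} {T : ℝ} {F : Fin n → ℝ → Conf m n → Pt m}
    {M : ℝ} (hM : ∀ i, ∀ t ∈ Icc (0:ℝ) T, ∀ X : Conf m n, ‖F i t X‖ ≤ M)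
    {k : ℝ} (hk : 0 < k) (hM0 : 0 ≤ M) {X : ℝ → Conf m n} (i : Fin n) {t : ℝ}
    (ht : t ∈ Icc (0:ℝ) T) (hb : distCl Ω (X t i) ≤ M / k) :
    ‖F i t (X t) - k • dGradd Ω (X t i)‖ ≤ 2 * M := by
  have h1 : ‖dGradd Ω (X t i)‖ ≤ M / k := by
    unfold dGradd
    split_ifs
    · simp; positivity
    · rw [norm_smul, Real.norm_of_nonneg (show 0 ≤ distCl Ω (X t i) from Metric.infDist_nonneg)]
      have := pc_norm_grad_le Ω (X t i)
      have h0 : 0 ≤ distCl Ω (X t i) := Metric.infDist_nonneg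
      nlinarith
  have h2 : ‖k • dGradd Ω (X t i)‖ ≤ M := by
    rw [norm_smul, Real.norm_of_nonneg hk.le]
    calc k * _ ≤ k * (M / k) := by gcongr
      _ = M := by field_simp
  have := norm_sub_le (F i t (X t)) (k • dGradd Ω (X t i))
  linarith [hM i t ht (X t)]

/-- **Lemma (compactness of the penalized solutions).**
A subsequence of the penalized solutions `X^k` converges, strongly in
`C⁰([0,T];ℝ^m)` and with velocities weakly-* in `L^∞(0,T;ℝ^m)`, to a limit
`X ∈ W^{1,∞}(0,T) ∩ C⁰([0,T];G)`. -/
theorem penalized_compactness {m n : ℕ} (Ω : Set (Pt m)) (ν : Pt m → Pt m)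
    (hΩ : IsC2Domain Ω ν) (ε : ℝ) (hε : 0 < ε)
    (hd1 : ContDiffOn ℝ 2 (distCl Ω) (closure (Metric.thickening ε (frontier Ω)) \ Ω))
    (hd2 : ∀ x ∈ closure (Metric.thickening ε Ω) \ closure Ω,
      ContDiffAt ℝ 2 (distCl Ω) x)
    (T : ℝ) (hT : 0 < T) (F : Fin n → ℝ → Conf m n → Pt m)
    (hFc : ∀ i, Continuous (Function.uncurry (F i)))
    (M : ℝ) (hM : ∀ i, ∀ t ∈ Icc (0:ℝ) T, ∀ X : Conf m n, ‖F i t X‖ ≤ M)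
    (k₀ : ℕ) (hk₀ : M / ε < (k₀ : ℝ))
    (X0 : Conf m n) (hX0 : X0 ∈ Gset Ω n)
    (Xk : ℕ → ℝ → Conf m n)
    (hsol : ∀ k, k₀ ≤ k → IsPenalSol Ω F T (k : ℝ) X0 (Xk k)) :
    ∃ φ : ℕ → ℕ, StrictMono φ ∧ (∀ k, k₀ ≤ φ k) ∧
      ∃ X : ℝ → Conf m n, ∃ v : Fin n → ℝ → Pt m,
        (∀ i, ∃ K : ℝ≥0, LipschitzOnWith K (fun t => X t i) (Icc 0 T)) ∧
        (∀ t ∈ Icc (0:ℝ) T, X t ∈ Gset Ω n) ∧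
        (∀ i, TendstoUniformlyOn (fun k t => Xk (φ k) t i) (fun t => X t i)
          atTop (Icc 0 T)) ∧
        (∀ i, ∀ᵐ t ∂(volume.restrict (Icc 0 T)),
          HasDerivWithinAt (fun s => X s i) (v i t) (Icc 0 T) t) ∧
        (∀ i, ∀ ψ : ℝ → Pt m, IntegrableOn ψ (Icc 0 T) →
          Tendsto (fun k => ∫ t in Icc (0:ℝ) T,
              ⟪F i t (Xk (φ k) t) - ((φ k : ℝ)) • dGradd Ω (Xk (φ k) t i), ψ t⟫)
            atTop (𝓝 (∫ t in Icc (0:ℝ) T, ⟪v i t, ψ t⟫))) := by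
  rcases isEmpty_or_nonempty (Fin n) with hn | hn
  · refine ⟨fun k => k₀ + k, fun a b h => Nat.add_lt_add_left h k₀, fun k => Nat.le_add_right _ _,
      Xk 0, fun i => hn.elim i, fun i => hn.elim i, fun t _ i => hn.elim i, fun i => hn.elim i,
      fun i => hn.elim i, fun i => hn.elim i⟩
  have hM0 : 0 ≤ M := by
    obtain ⟨i⟩ := hn
    exact (norm_nonneg _).trans (hM i 0 ⟨le_rfl, hT.le⟩ 0)
  have hpos : ∀ k : ℕ, k₀ ≤ k → (0:ℝ) < k ∧ M / (k:ℝ) < ε := by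
    intro k hk
    have h1 : (k₀ : ℝ) ≤ k := by exact_mod_cast hk
    have h2 : M / ε < k := hk₀.trans_le h1
    have h3 : (0:ℝ) < k := lt_of_le_of_lt (by positivity) h2
    refine ⟨h3, ?_⟩
    rw [div_lt_iff₀ hε] at h2
    rw [div_lt_iff₀ h3]
    linarith
  have hdist : ∀ k, k₀ ≤ k → ∀ i, ∀ t ∈ Icc (0:ℝ) T, distCl Ω (Xk k t i) ≤ M / k :=
    fun k hk i => pc_dist_bound hΩ.nonempty hd2 hM (hpos k hk).1 (hpos k hk).2 hM0 hX0
      (hsol k hk) i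
  set K : ℝ≥0 := ⟨2 * M, by positivity⟩ with hK
  have hlipi : ∀ k, k₀ ≤ k → ∀ i, LipschitzOnWith K (fun t => Xk k t i) (Icc 0 T) := by
    intro k hk i
    refine (convex_Icc 0 T).lipschitzOnWith_of_nnnorm_hasDerivWithin_le ((hsol k hk).2 i) ?_
    intro t ht
    rw [← NNReal.coe_le_coe]
    exact pc_vel_bound hM (hpos k hk).1 hM0 i ht (hdist k hk i t ht)
  have hlip : ∀ k, LipschitzWith K (fun t : Icc (0:ℝ) T => Xk (k₀ + k) t) := by
    intro k
    refine LipschitzWith.of_dist_le_mul fun s t => ?_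
    rw [dist_pi_le_iff (by positivity)]
    intro i
    exact (hlipi (k₀ + k) (Nat.le_add_right _ _) i).dist_le_mul s s.2 t t.2
  let g : ℕ → BoundedContinuousFunction (Icc (0:ℝ) T) (Conf m n) := fun k =>
    BoundedContinuousFunction.mkOfCompact ⟨fun t => Xk (k₀ + k) t, (hlip k).continuous⟩
  have hg : ∀ k t, g k t = Xk (k₀ + k) t := fun k t => rfl
  have hcomp : IsCompact (closure (range g)) := by
    refine BoundedContinuousFunction.arzela_ascoli (Metric.closedBall X0 (K * T))
      (isCompact_closedBall _ _) _ ?_ ?_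
    · rintro _ t ⟨k, rfl⟩
      have h0 : X0 = g k ⟨0, le_rfl, hT.le⟩ :=
        ((hsol (k₀ + k) (Nat.le_add_right _ _)).1).symm
      rw [Metric.mem_closedBall, h0]
      refine ((hlip k).dist_le_mul t ⟨0, le_rfl, hT.le⟩).trans ?_
      gcongr
      rw [Subtype.dist_eq, Real.dist_eq, sub_zero, abs_of_nonneg t.2.1]
      exact t.2.2
    · refine (LipschitzWith.uniformEquicontinuous _ K ?_).equicontinuous
      rintro ⟨_, k, rfl⟩
      exact hlip k
  obtain ⟨G, -, σ, hσ, hG⟩ := hcomp.tendsto_subseq (fun k => subset_closure ⟨k, rfl⟩)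
  rw [BoundedContinuousFunction.tendsto_iff_tendstoUniformly] at hG
  have hGp : ∀ t, Tendsto (fun k => Xk (k₀ + σ k) (t : Icc (0:ℝ) T)) atTop (𝓝 (G t)) :=
    fun t => hG.tendsto_at t
  let P : ℝ → Icc (0:ℝ) T := projIcc 0 T hT.le
  have hP : LipschitzWith 1 P := LipschitzWith.projIcc hT.le
  have hPm : ∀ t (ht : t ∈ Icc (0:ℝ) T), P t = ⟨t, ht⟩ := fun t ht => projIcc_of_mem hT.le ht
  have hYl : ∀ k i, LipschitzWith K (fun t => Xk (k₀ + σ k) (P t) i) := by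
    intro k i
    refine LipschitzWith.of_dist_le_mul fun s t => ?_
    refine (dist_le_pi_dist (Xk (k₀ + σ k) (P s)) (Xk (k₀ + σ k) (P t)) i).trans ?_
    refine ((hlip (σ k)).dist_le_mul (P s) (P t)).trans ?_
    gcongr
    simpa using hP.dist_le_mul s t
  have hYt : ∀ i t, Tendsto (fun k => Xk (k₀ + σ k) (P t) i) atTop (𝓝 (G (P t) i)) :=
    fun i t => ((continuous_apply i).tendsto _).comp (hGp (P t))
  have hXl : ∀ i, LipschitzWith K (fun t => G (P t) i) := by
    intro i
    refine LipschitzWith.of_dist_le_mul fun s t => ?_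
    exact le_of_tendsto ((hYt i s).dist (hYt i t))
      (Eventually.of_forall fun k => (hYl k i).dist_le_mul s t)
  have hφ : StrictMono (fun k => k₀ + σ k) := fun a b h => Nat.add_lt_add_left (hσ h) k₀
  refine ⟨fun k => k₀ + σ k, hφ, fun k => Nat.le_add_right _ _, fun t => G (P t),
    fun i => deriv (fun t => G (P t) i), ?_, ?_, ?_, ?_, ?_⟩
  · exact fun i => ⟨K, (hXl i).lipschitzOnWith⟩
  · intro t ht i
    have hl : LipschitzWith 1 (distCl Ω) := Metric.lipschitz_infDist_pt (closure Ω)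
    have h1 : Tendsto (fun k => distCl Ω (Xk (k₀ + σ k) (P t) i)) atTop
        (𝓝 (distCl Ω (G (P t) i))) := (hl.continuous.tendsto _).comp (hYt i t)
    have h2 : Tendsto (fun k => M / ((k₀ + σ k : ℕ) : ℝ)) atTop (𝓝 0) :=
      (tendsto_const_div_atTop_nhds_zero_nat M).comp hφ.tendsto_atTop
    have h3 : distCl Ω (G (P t) i) ≤ 0 := le_of_tendsto_of_tendsto' h1 h2 fun k =>
      hdist _ (Nat.le_add_right _ _) i _ (P t).2
    have h4 : distCl Ω (G (P t) i) = 0 := le_antisymm h3 Metric.infDist_nonneg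
    rw [← closure_closure]
    exact (Metric.mem_closure_iff_infDist_zero hΩ.nonempty.closure).2 h4
  · intro i
    rw [Metric.tendstoUniformlyOn_iff]
    intro δ hδ
    filter_upwards [Metric.tendstoUniformly_iff.1 hG δ hδ] with k hk t ht
    refine lt_of_le_of_lt ?_ (hk ⟨t, ht⟩)
    rw [hPm t ht]
    exact dist_le_pi_dist (G ⟨t, ht⟩) (Xk (k₀ + σ k) t) i
  · intro i
    refine ae_restrict_of_ae ?_
    filter_upwards [(hXl i).ae_differentiableAt_real] with t ht
    exact ht.hasDerivAt.hasDerivWithinAt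
  · intro i ψ hψ
    have hw := pc_vec_weak measurableSet_Icc (fun k => hYl k i) (hXl i) (hYt i) hψ
    refine hw.congr fun k => ?_
    rw [integral_Icc_eq_integral_Ioo, integral_Icc_eq_integral_Ioo]
    refine setIntegral_congr_fun measurableSet_Ioo fun t ht => ?_
    have hnb : Icc 0 T ∈ 𝓝 t := Icc_mem_nhds ht.1 ht.2
    have hd := ((hsol (k₀ + σ k) (Nat.le_add_right _ _)).2 i t
      (Ioo_subset_Icc_self ht)).hasDerivAt hnb
    have he : (fun t => Xk (k₀ + σ k) (P t) i) =ᶠ[𝓝 t] fun t => Xk (k₀ + σ k) t i := by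
      filter_upwards [hnb] with s hs
      rw [hPm s hs]
    have := he.deriv_eq.trans hd.deriv
    simp only [this]
end
end
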